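/- Let p_{Y1,Y2|X} be a discrete memoryless broadcast channel with finite alphabets. If p_{Y1|X} is essentially less noisy than p_{Y2|X}, then 𝒞₁(p_{Y1,Y2|X}) = 𝒞(p_{Y1,Y2|X}). -/

import Mathlib

open scoped BigOperators Classical
open Finset

noncomputable section

/-- `p` is a probability mass function on the finite type `α`. -/
def IsPMF {α : Type} [Fintype α] (p : α → ℝ) : Prop :=
  (∀ a, 0 ≤ p a) ∧ ∑ a, p a = 1

/-- Shannon entropy (base 2) of a pmf on a finite type. -/
def Hent {α : Type} [Fintype α] (p : α → ℝ) : ℝ :=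
  -∑ a, p a * Real.logb 2 (p a)

/-- Mutual information `I(A;B)` of a joint pmf on `α × β` (base-2 logarithms). -/
def MI {α β : Type} [Fintype α] [Fintype β] (p : α × β → ℝ) : ℝ :=
  Hent (fun a => ∑ b, p (a, b)) + Hent (fun b => ∑ a, p (a, b)) - Hent p

/-- Conditional mutual information `I(A;B|C)` of a joint pmf on `α × β × γ`. -/
def CMI {α β γ : Type} [Fintype α] [Fintype β] [Fintype γ] (p : α × β × γ → ℝ) : ℝ :=
  Hent (fun ac : α × γ => ∑ b, p (ac.1, b, ac.2))
    + Hent (fun bc : β × γ => ∑ a, p (a, bc.1, bc.2))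
    - Hent p
    - Hent (fun c : γ => ∑ a, ∑ b, p (a, b, c))

/-- A channel: every input letter gives a pmf on outputs. -/
def IsChannel {X Z : Type} [Fintype Z] (W : X → Z → ℝ) : Prop :=
  ∀ x, IsPMF (W x)

/-- Marginal channel to receiver 1 of a broadcast channel. -/
def margW1 {X Y1 Y2 : Type} [Fintype Y2] (W : X → Y1 × Y2 → ℝ) : X → Y1 → ℝ :=
  fun x y1 => ∑ y2, W x (y1, y2)

/-- Marginal channel to receiver 2 of a broadcast channel. -/
def margW2 {X Y1 Y2 : Type} [Fintype Y1] (W : X → Y1 × Y2 → ℝ) : X → Y2 → ℝ :=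
  fun x y2 => ∑ y1, W x (y1, y2)

/-- Memoryless `n`-fold extension of a broadcast channel. -/
def nFold {X Y1 Y2 : Type} (W : X → Y1 × Y2 → ℝ) (n : ℕ)
    (x : Fin n → X) (y : (Fin n → Y1) × (Fin n → Y2)) : ℝ :=
  ∏ t, W (x t) (y.1 t, y.2 t)

section Channel

variable {X Y1 Y2 : Type} [Fintype Y1] [Fintype Y2]

/-- Average error probability; message `M2` known at receiver 1. -/
def errP1 (W : X → Y1 × Y2 → ℝ) (n k1 k2 : ℕ) (f : Fin k1 × Fin k2 → Fin n → X)
    (g1 : (Fin n → Y1) × Fin k2 → Fin k1) (g2 : (Fin n → Y2) → Fin k2) : ℝ :=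
  (1 : ℝ) / ((k1 : ℝ) * (k2 : ℝ)) *
    ∑ m : Fin k1 × Fin k2, ∑ y : (Fin n → Y1) × (Fin n → Y2),
      nFold W n (f m) y * (if g1 (y.1, m.2) = m.1 ∧ g2 y.2 = m.2 then 0 else 1)

/-- Average error probability; message `M1` known at receiver 2. -/
def errP2 (W : X → Y1 × Y2 → ℝ) (n k1 k2 : ℕ) (f : Fin k1 × Fin k2 → Fin n → X)
    (g1 : (Fin n → Y1) → Fin k1) (g2 : (Fin n → Y2) × Fin k1 → Fin k2) : ℝ :=
  (1 : ℝ) / ((k1 : ℝ) * (k2 : ℝ)) *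
    ∑ m : Fin k1 × Fin k2, ∑ y : (Fin n → Y1) × (Fin n → Y2),
      nFold W n (f m) y * (if g1 y.1 = m.1 ∧ g2 (y.2, m.1) = m.2 then 0 else 1)

/-- Average error probability; no receiver side information. -/
def errP0 (W : X → Y1 × Y2 → ℝ) (n k1 k2 : ℕ) (f : Fin k1 × Fin k2 → Fin n → X)
    (g1 : (Fin n → Y1) → Fin k1) (g2 : (Fin n → Y2) → Fin k2) : ℝ :=
  (1 : ℝ) / ((k1 : ℝ) * (k2 : ℝ)) *
    ∑ m : Fin k1 × Fin k2, ∑ y : (Fin n → Y1) × (Fin n → Y2),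
      nFold W n (f m) y * (if g1 y.1 = m.1 ∧ g2 y.2 = m.2 then 0 else 1)

/-- Achievability of a rate pair with `M2` available at receiver 1. -/
def Ach1 (W : X → Y1 × Y2 → ℝ) (R : ℝ × ℝ) : Prop :=
  0 ≤ R.1 ∧ 0 ≤ R.2 ∧ ∀ ε : ℝ, 0 < ε →
    ∃ (n k1 k2 : ℕ), 0 < n ∧ 0 < k1 ∧ 0 < k2 ∧
      ∃ (f : Fin k1 × Fin k2 → Fin n → X) (g1 : (Fin n → Y1) × Fin k2 → Fin k1)
        (g2 : (Fin n → Y2) → Fin k2),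
        R.1 ≤ Real.logb 2 (k1 : ℝ) / (n : ℝ) ∧ R.2 ≤ Real.logb 2 (k2 : ℝ) / (n : ℝ) ∧
        errP1 W n k1 k2 f g1 g2 ≤ ε

/-- Achievability of a rate pair with `M1` available at receiver 2. -/
def Ach2 (W : X → Y1 × Y2 → ℝ) (R : ℝ × ℝ) : Prop :=
  0 ≤ R.1 ∧ 0 ≤ R.2 ∧ ∀ ε : ℝ, 0 < ε →
    ∃ (n k1 k2 : ℕ), 0 < n ∧ 0 < k1 ∧ 0 < k2 ∧
      ∃ (f : Fin k1 × Fin k2 → Fin n → X) (g1 : (Fin n → Y1) → Fin k1)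
        (g2 : (Fin n → Y2) × Fin k1 → Fin k2),
        R.1 ≤ Real.logb 2 (k1 : ℝ) / (n : ℝ) ∧ R.2 ≤ Real.logb 2 (k2 : ℝ) / (n : ℝ) ∧
        errP2 W n k1 k2 f g1 g2 ≤ ε

/-- Achievability of a rate pair with no receiver side information. -/
def Ach0 (W : X → Y1 × Y2 → ℝ) (R : ℝ × ℝ) : Prop :=
  0 ≤ R.1 ∧ 0 ≤ R.2 ∧ ∀ ε : ℝ, 0 < ε →
    ∃ (n k1 k2 : ℕ), 0 < n ∧ 0 < k1 ∧ 0 < k2 ∧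
      ∃ (f : Fin k1 × Fin k2 → Fin n → X) (g1 : (Fin n → Y1) → Fin k1)
        (g2 : (Fin n → Y2) → Fin k2),
        R.1 ≤ Real.logb 2 (k1 : ℝ) / (n : ℝ) ∧ R.2 ≤ Real.logb 2 (k2 : ℝ) / (n : ℝ) ∧
        errP0 W n k1 k2 f g1 g2 ≤ ε

/-- Capacity region `𝒞₁`: side information `M2` at receiver 1. -/
def Cap1 (W : X → Y1 × Y2 → ℝ) : Set (ℝ × ℝ) := closure {R | Ach1 W R}

/-- Capacity region `𝒞₂`: side information `M1` at receiver 2. -/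
def Cap2 (W : X → Y1 × Y2 → ℝ) : Set (ℝ × ℝ) := closure {R | Ach2 W R}

/-- Private-message capacity region `𝒞`. -/
def Cap (W : X → Y1 × Y2 → ℝ) : Set (ℝ × ℝ) := closure {R | Ach0 W R}

end Channel

/-- `κ·𝒜` for a set of rate pairs. -/
def scaleSet (κ : ℝ) (A : Set (ℝ × ℝ)) : Set (ℝ × ℝ) :=
  (fun R : ℝ × ℝ => (κ * R.1, κ * R.2)) '' A

/-- Binary entropy function (base 2). -/
def Hb (x : ℝ) : ℝ := -(x * Real.logb 2 x) - (1 - x) * Real.logb 2 (1 - x)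

/-- Binary convolution `a*b = a(1-b)+(1-a)b`. -/
def bconv (a b : ℝ) : ℝ := a * (1 - b) + (1 - a) * b

/-- The region `𝒞(BS-BC(d₁,d₂))`. -/
def CBSBC (d1 d2 : ℝ) : Set (ℝ × ℝ) :=
  {R | 0 ≤ R.1 ∧ 0 ≤ R.2 ∧ ∃ α ∈ Set.Icc (0:ℝ) (1/2),
    R.1 ≤ Hb (bconv α d1) - Hb d1 ∧ R.2 ≤ 1 - Hb (bconv α d2)}

/-- The region `𝒞(BE-BC(ε₁,ε₂))`. -/
def CBEBC (e1 e2 : ℝ) : Set (ℝ × ℝ) :=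
  {R | 0 ≤ R.1 ∧ 0 ≤ R.2 ∧ ∃ β ∈ Set.Icc (0:ℝ) 1,
    R.1 ≤ β * (1 - e1) ∧ R.2 ≤ (1 - β) * (1 - e2)}

/-- 1-norm distance between two functions on a finite type. -/
def l1dist {α : Type} [Fintype α] (p q : α → ℝ) : ℝ := ∑ a, |p a - q a|

/-- Capacity `C(p_{Y|X}) = max_{p_X} I(X;Y)` of a point-to-point channel. -/
def Cmarg {X Y : Type} [Fintype X] [Fintype Y] (Wm : X → Y → ℝ) : ℝ :=
  sSup {r | ∃ pX : X → ℝ, IsPMF pX ∧ r = MI (fun a : X × Y => pX a.1 * Wm a.1 a.2)}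

section Auxiliary

variable {X Y : Type} [Fintype X] [Fintype Y]

/-- `I(V;Y)` for an auxiliary–input joint pmf `q` on `V × X` and a marginal
channel `Wm : X → Y`. -/
def IVY {V : Type} [Fintype V] (Wm : X → Y → ℝ) (q : V × X → ℝ) : ℝ :=
  MI (fun a : V × Y => ∑ x, q (a.1, x) * Wm x a.2)

/-- `I(X;Y|V)` for an auxiliary–input joint pmf `q` on `V × X` and a marginal
channel `Wm : X → Y`. -/
def IXYgV {V : Type} [Fintype V] (Wm : X → Y → ℝ) (q : V × X → ℝ) : ℝ :=
  CMI (fun a : X × Y × V => q (a.2.2, a.1) * Wm a.1 a.2.1)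

/-- `I(X;Y)` for an input pmf `pX` and a marginal channel `Wm : X → Y`. -/
def IXY (Wm : X → Y → ℝ) (pX : X → ℝ) : ℝ :=
  MI (fun a : X × Y => pX a.1 * Wm a.1 a.2)

end Auxiliary

section Sufficient

variable {X Y1 Y2 : Type} [Fintype X] [Fintype Y1] [Fintype Y2]

/-- `𝒫` is a sufficient class of input distributions for the broadcast channel `W`. -/
def SuffClass (W : X → Y1 × Y2 → ℝ) (P : Set (X → ℝ)) : Prop :=
  ∀ (k1 k2 : ℕ) (p : Fin k1 × Fin k2 × X → ℝ), IsPMF p →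
    ∃ (k1' k2' : ℕ) (p' : Fin k1' × Fin k2' × X → ℝ), IsPMF p' ∧
      (fun x => ∑ v1, ∑ v2, p' (v1, v2, x)) ∈ P ∧
      IVY (margW1 W) (fun a : Fin k1 × X => ∑ v2, p (a.1, v2, a.2))
        ≤ IVY (margW1 W) (fun a : Fin k1' × X => ∑ v2, p' (a.1, v2, a.2)) ∧
      IVY (margW2 W) (fun a : Fin k2 × X => ∑ v1, p (v1, a.1, a.2))
        ≤ IVY (margW2 W) (fun a : Fin k2' × X => ∑ v1, p' (v1, a.1, a.2)) ∧
      IVY (margW1 W) (fun a : Fin k1 × X => ∑ v2, p (a.1, v2, a.2))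
          + IXYgV (margW2 W) (fun a : Fin k1 × X => ∑ v2, p (a.1, v2, a.2))
        ≤ IVY (margW1 W) (fun a : Fin k1' × X => ∑ v2, p' (a.1, v2, a.2))
          + IXYgV (margW2 W) (fun a : Fin k1' × X => ∑ v2, p' (a.1, v2, a.2)) ∧
      IXYgV (margW1 W) (fun a : Fin k2 × X => ∑ v1, p (v1, a.1, a.2))
          + IVY (margW2 W) (fun a : Fin k2 × X => ∑ v1, p (v1, a.1, a.2))
        ≤ IXYgV (margW1 W) (fun a : Fin k2' × X => ∑ v1, p' (v1, a.1, a.2))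
          + IVY (margW2 W) (fun a : Fin k2' × X => ∑ v1, p' (v1, a.1, a.2))

/-- `p_{Y1|X}` is essentially less noisy than `p_{Y2|X}`. -/
def EssLessNoisy (W : X → Y1 × Y2 → ℝ) : Prop :=
  ∃ P : Set (X → ℝ), SuffClass W P ∧
    ∀ (k : ℕ) (q : Fin k × X → ℝ), IsPMF q → (fun x => ∑ v, q (v, x)) ∈ P →
      IVY (margW2 W) q ≤ IVY (margW1 W) q

/-- `p_{Y1|X}` is essentially more capable than `p_{Y2|X}`. -/
def EssMoreCapable (W : X → Y1 × Y2 → ℝ) : Prop :=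
  ∃ P : Set (X → ℝ), SuffClass W P ∧
    ∀ (k : ℕ) (q : Fin k × X → ℝ), IsPMF q → (fun x => ∑ v, q (v, x)) ∈ P →
      IXYgV (margW2 W) q ≤ IXYgV (margW1 W) q

end Sufficient

set_option linter.unusedSectionVars false
section Ent
variable {Ω α β γ : Type} [Fintype Ω] [Fintype α] [Fintype β] [Fintype γ]

/-- Law of a random variable on a finite probability space. -/
def pr {Ω α : Type} [Fintype Ω] (P : Ω → ℝ) (A : Ω → α) (a : α) : ℝ :=
  ∑ ω, if A ω = a then P ω else 0

/-- Entropy of a random variable on a finite probability space. -/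
def HR {Ω α : Type} [Fintype Ω] (P : Ω → ℝ) (A : Ω → α) : ℝ :=
  -∑ ω, P ω * Real.logb 2 (pr P A (A ω))

theorem pr_nonneg {P : Ω → ℝ} (hP : ∀ ω, 0 ≤ P ω) (A : Ω → α) (a : α) : 0 ≤ pr P A a :=
  Finset.sum_nonneg fun ω _ => by split_ifs <;> simp [hP]

theorem le_pr {P : Ω → ℝ} (hP : ∀ ω, 0 ≤ P ω) (A : Ω → α) (ω : Ω) : P ω ≤ pr P A (A ω) := by
  unfold pr
  have := Finset.single_le_sum (f := fun ω' => if A ω' = A ω then P ω' else 0)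
    (fun ω' _ => by split_ifs <;> simp [hP]) (Finset.mem_univ ω)
  simpa using this

theorem pr_le_of {P : Ω → ℝ} (hP : ∀ ω, 0 ≤ P ω) {A : Ω → α} {B : Ω → β} {a : α} {b : β}
    (h : ∀ ω, A ω = a → B ω = b) : pr P A a ≤ pr P B b := by
  unfold pr
  refine Finset.sum_le_sum fun ω _ => ?_
  by_cases h1 : A ω = a
  · simp [h1, h ω h1]
  · simp only [h1, if_false]; split_ifs <;> simp [hP]

theorem sum_pr_mul (P : Ω → ℝ) (A : Ω → α) (F : α → ℝ) :
    ∑ a, pr P A a * F a = ∑ ω, P ω * F (A ω) := by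
  simp only [pr, Finset.sum_mul]
  rw [Finset.sum_comm]
  refine Finset.sum_congr rfl fun ω _ => ?_
  simp [ite_mul]

theorem sum_pr (P : Ω → ℝ) (A : Ω → α) : ∑ a, pr P A a = ∑ ω, P ω := by
  simpa using sum_pr_mul P A (fun _ => 1)

theorem isPMF_pr {P : Ω → ℝ} (hP : IsPMF P) (A : Ω → α) : IsPMF (pr P A) :=
  ⟨pr_nonneg hP.1 A, by rw [sum_pr, hP.2]⟩

theorem Hent_pr (P : Ω → ℝ) (A : Ω → α) : Hent (pr P A) = HR P A := by
  unfold Hent HR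
  rw [sum_pr_mul P A (fun a => Real.logb 2 (pr P A a))]

theorem sum_pr_left (P : Ω → ℝ) (A : Ω → α) (B : Ω → β) (b : β) :
    ∑ a, pr P (fun ω => (A ω, B ω)) (a, b) = pr P B b := by
  unfold pr
  rw [Finset.sum_comm]
  refine Finset.sum_congr rfl fun ω _ => ?_
  by_cases h : B ω = b <;> simp [h]

theorem sum_pr_right (P : Ω → ℝ) (A : Ω → α) (B : Ω → β) (a : α) :
    ∑ b, pr P (fun ω => (A ω, B ω)) (a, b) = pr P A a := by
  unfold pr
  rw [Finset.sum_comm]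
  refine Finset.sum_congr rfl fun ω _ => ?_
  by_cases h : A ω = a <;> simp [h]

theorem HR_mono {P : Ω → ℝ} (hP : ∀ ω, 0 ≤ P ω) {A : Ω → α} {B : Ω → β}
    (h : ∀ ω ω', A ω = A ω' → B ω = B ω') : HR P B ≤ HR P A := by
  unfold HR
  apply neg_le_neg
  refine Finset.sum_le_sum fun ω _ => ?_
  rcases (hP ω).eq_or_lt with h0 | h0
  · simp [← h0]
  · have h1 : 0 < pr P A (A ω) := h0.trans_le (le_pr hP A ω)
    have h2 : pr P A (A ω) ≤ pr P B (B ω) := pr_le_of hP fun ω' hh => h _ _ hh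
    exact mul_le_mul_of_nonneg_left
      (Real.logb_le_logb_of_le (by norm_num) h1 h2) h0.le

theorem HR_congr {P : Ω → ℝ} (hP : ∀ ω, 0 ≤ P ω) {A : Ω → α} {B : Ω → β}
    (h : ∀ ω ω', A ω = A ω' ↔ B ω = B ω') : HR P B = HR P A :=
  le_antisymm (HR_mono hP fun ω ω' => (h ω ω').1) (HR_mono hP fun ω ω' => (h ω ω').2)

theorem HR_const {P : Ω → ℝ} (hP : IsPMF P) {A : Ω → α} (h : ∀ ω ω', A ω = A ω') :
    HR P A = 0 := by
  unfold HR
  have : ∀ ω, pr P A (A ω) = 1 := fun ω => by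
    unfold pr
    rw [← hP.2]
    exact Finset.sum_congr rfl fun ω' _ => by simp [h ω' ω]
  simp [this]

theorem gibbs {P : Ω → ℝ} (hP : IsPMF P) (h : Ω → ℝ) (hpos : ∀ ω, 0 < P ω → 0 < h ω)
    (hs : ∑ ω, P ω * h ω ≤ 1) : ∑ ω, P ω * Real.logb 2 (h ω) ≤ 0 := by
  have hl : 0 < Real.log 2 := Real.log_pos (by norm_num)
  have key : ∑ ω, P ω * Real.log (h ω) ≤ 0 := by
    calc ∑ ω, P ω * Real.log (h ω) ≤ ∑ ω, (P ω * h ω - P ω) := by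
          refine Finset.sum_le_sum fun ω _ => ?_
          rcases (hP.1 ω).eq_or_lt with h0 | h0
          · simp [← h0]
          · have := Real.log_le_sub_one_of_pos (hpos ω h0)
            nlinarith
      _ ≤ 0 := by rw [Finset.sum_sub_distrib, hP.2]; linarith
  have : ∑ ω, P ω * Real.logb 2 (h ω) = (∑ ω, P ω * Real.log (h ω)) / Real.log 2 := by
    rw [Finset.sum_div]
    exact Finset.sum_congr rfl fun ω _ => by rw [Real.logb, mul_div_assoc]
  rw [this]
  exact div_nonpos_of_nonpos_of_nonneg key hl.le

theorem HR_submod {P : Ω → ℝ} (hP : IsPMF P) (A : Ω → α) (B : Ω → β) (C : Ω → γ) :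
    HR P (fun ω => (A ω, B ω, C ω)) + HR P C
      ≤ HR P (fun ω => (A ω, C ω)) + HR P (fun ω => (B ω, C ω)) := by
  set pABC := pr P (fun ω => (A ω, B ω, C ω)) with hABC
  set pAC := pr P (fun ω => (A ω, C ω)) with hAC
  set pBC := pr P (fun ω => (B ω, C ω)) with hBC
  set pC := pr P C with hC
  have n1 : ∀ x, 0 ≤ pABC x := fun x => pr_nonneg hP.1 _ x
  have n2 : ∀ x, 0 ≤ pAC x := fun x => pr_nonneg hP.1 _ x
  have n3 : ∀ x, 0 ≤ pBC x := fun x => pr_nonneg hP.1 _ x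
  have n4 : ∀ x, 0 ≤ pC x := fun x => pr_nonneg hP.1 _ x
  have p1 : ∀ ω, 0 < P ω → 0 < pABC (A ω, B ω, C ω) := fun ω h =>
    h.trans_le (le_pr hP.1 (fun ω => (A ω, B ω, C ω)) ω)
  have p2 : ∀ ω, 0 < P ω → 0 < pAC (A ω, C ω) := fun ω h =>
    h.trans_le (le_pr hP.1 (fun ω => (A ω, C ω)) ω)
  have p3 : ∀ ω, 0 < P ω → 0 < pBC (B ω, C ω) := fun ω h =>
    h.trans_le (le_pr hP.1 (fun ω => (B ω, C ω)) ω)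
  have p4 : ∀ ω, 0 < P ω → 0 < pC (C ω) := fun ω h => h.trans_le (le_pr hP.1 C ω)
  have g := gibbs hP (fun ω => pAC (A ω, C ω) * pBC (B ω, C ω) /
      (pABC (A ω, B ω, C ω) * pC (C ω)))
    (fun ω h => div_pos (mul_pos (p2 ω h) (p3 ω h)) (mul_pos (p1 ω h) (p4 ω h))) (by
      rw [← sum_pr_mul P (fun ω => (A ω, B ω, C ω))
        (fun t => pAC (t.1, t.2.2) * pBC (t.2.1, t.2.2) / (pABC t * pC t.2.2))]
      calc _ ≤ ∑ t : α × β × γ, pAC (t.1, t.2.2) * pBC (t.2.1, t.2.2) / pC t.2.2 := by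
            refine Finset.sum_le_sum fun t _ => ?_
            rw [← hABC]
            rcases (n1 t).eq_or_lt with h0 | h0
            · rw [← h0, zero_mul]
              exact div_nonneg (mul_nonneg (n2 _) (n3 _)) (n4 _)
            · rw [mul_div_assoc', mul_div_mul_left _ _ h0.ne']
        _ = ∑ c, (∑ a, pAC (a, c)) * (∑ b, pBC (b, c)) / pC c := by
            rw [Fintype.sum_prod_type]
            simp only [Fintype.sum_prod_type]
            have : ∀ a : α, ∑ b : β, ∑ c : γ, pAC (a, c) * pBC (b, c) / pC c
              = ∑ c : γ, pAC (a, c) * (∑ b, pBC (b, c)) / pC c := by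
              intro a
              rw [Finset.sum_comm]
              exact Finset.sum_congr rfl fun c _ => by rw [Finset.mul_sum, Finset.sum_div]
            simp only [this]
            rw [Finset.sum_comm]
            exact Finset.sum_congr rfl fun c _ => by rw [Finset.sum_mul, Finset.sum_div]
        _ ≤ ∑ c, pC c := by
            refine Finset.sum_le_sum fun c _ => ?_
            rw [hAC, hBC, sum_pr_left, sum_pr_left, ← hC]
            rcases (n4 c).eq_or_lt with h0 | h0
            · simp [← h0]
            · rw [mul_div_assoc, div_self h0.ne', mul_one]
        _ = 1 := by rw [hC, sum_pr, hP.2])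
  have e : ∑ ω, P ω * Real.logb 2 (pAC (A ω, C ω) * pBC (B ω, C ω) /
      (pABC (A ω, B ω, C ω) * pC (C ω))) = HR P (fun ω => (A ω, B ω, C ω)) + HR P C
      - HR P (fun ω => (A ω, C ω)) - HR P (fun ω => (B ω, C ω)) := by
    simp only [HR, ← hABC, ← hAC, ← hBC, ← hC]
    rw [← Finset.sum_neg_distrib, ← Finset.sum_neg_distrib, ← Finset.sum_neg_distrib,
      ← Finset.sum_neg_distrib, ← Finset.sum_add_distrib, ← Finset.sum_sub_distrib,
      ← Finset.sum_sub_distrib]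
    refine Finset.sum_congr rfl fun ω _ => ?_
    rcases (hP.1 ω).eq_or_lt with h0 | h0
    · simp [← h0]
    · rw [Real.logb_div (mul_pos (p2 ω h0) (p3 ω h0)).ne' (mul_pos (p1 ω h0) (p4 ω h0)).ne',
        Real.logb_mul (p2 ω h0).ne' (p3 ω h0).ne', Real.logb_mul (p1 ω h0).ne' (p4 ω h0).ne']
      ring
  rw [e] at g
  linarith

theorem fano {P : Ω → ℝ} (hP : IsPMF P) (M : Ω → α) (Y : Ω → β) (g : β → α)
    {δ ε : ℝ} (hδ : 0 < δ) (hδ1 : δ < 1)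
    (herr : ∑ ω, P ω * (if g (Y ω) = M ω then 0 else 1) ≤ ε) :
    HR P (fun ω => (M ω, Y ω)) - HR P Y
      ≤ -Real.logb 2 (1 - δ) + ε * (Real.logb 2 (Fintype.card α) - Real.logb 2 δ) := by
  have hne : Nonempty α := by
    by_contra hc
    rw [not_nonempty_iff] at hc
    have : IsEmpty Ω := ⟨fun ω => hc.elim (M ω)⟩
    have := hP.2
    simp at this
  have hk : (1 : ℝ) ≤ Fintype.card α := by exact_mod_cast Fintype.card_pos
  have hk0 : (0 : ℝ) < Fintype.card α := by linarith
  set k : ℝ := (Fintype.card α : ℝ) with hkdef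
  set q : α → β → ℝ := fun m y => if g y = m then 1 - δ else δ / k with hq
  have hq0 : ∀ m y, 0 < q m y := fun m y => by
    simp only [hq]; split_ifs
    · linarith
    · positivity
  set pMY := pr P (fun ω => (M ω, Y ω)) with hMY
  set pY := pr P Y with hY
  have n1 : ∀ x, 0 ≤ pMY x := fun x => pr_nonneg hP.1 _ x
  have n4 : ∀ x, 0 ≤ pY x := fun x => pr_nonneg hP.1 _ x
  have p1 : ∀ ω, 0 < P ω → 0 < pMY (M ω, Y ω) := fun ω h =>
    h.trans_le (le_pr hP.1 (fun ω => (M ω, Y ω)) ω)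
  have p4 : ∀ ω, 0 < P ω → 0 < pY (Y ω) := fun ω h => h.trans_le (le_pr hP.1 Y ω)
  have hqs : ∀ y, ∑ m, q m y ≤ 1 := fun y => by
    calc ∑ m, q m y ≤ ∑ m, ((if g y = m then 1 - δ else 0) + δ / k) := by
          refine Finset.sum_le_sum fun m _ => ?_
          simp only [hq]
          split_ifs
          · have : 0 ≤ δ / k := by positivity
            linarith
          · linarith
      _ = 1 := by
          rw [Finset.sum_add_distrib]
          simp
          rw [← hkdef]
          field_simp
          ring
  have gg := gibbs hP (fun ω => q (M ω) (Y ω) * pY (Y ω) / pMY (M ω, Y ω))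
    (fun ω h => div_pos (mul_pos (hq0 _ _) (p4 ω h)) (p1 ω h)) (by
      rw [← sum_pr_mul P (fun ω => (M ω, Y ω)) (fun t => q t.1 t.2 * pY t.2 / pMY t)]
      calc _ ≤ ∑ t : α × β, q t.1 t.2 * pY t.2 := by
            refine Finset.sum_le_sum fun t _ => ?_
            rw [← hMY]
            rcases (n1 t).eq_or_lt with h0 | h0
            · rw [← h0, zero_mul]
              exact mul_nonneg (hq0 _ _).le (n4 _)
            · rw [mul_div_cancel₀ _ h0.ne']
        _ = ∑ y, (∑ m, q m y) * pY y := by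
            rw [Fintype.sum_prod_type_right]
            exact Finset.sum_congr rfl fun y _ => by rw [Finset.sum_mul]
        _ ≤ ∑ y, 1 * pY y := by
            exact Finset.sum_le_sum fun y _ => mul_le_mul_of_nonneg_right (hqs y) (n4 y)
        _ = 1 := by simp only [one_mul]; rw [hY, sum_pr, hP.2])
  have e : ∑ ω, P ω * Real.logb 2 (q (M ω) (Y ω) * pY (Y ω) / pMY (M ω, Y ω))
      = HR P (fun ω => (M ω, Y ω)) - HR P Y + ∑ ω, P ω * Real.logb 2 (q (M ω) (Y ω)) := by
    simp only [HR, ← hMY, ← hY]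
    rw [← Finset.sum_neg_distrib, ← Finset.sum_neg_distrib, ← Finset.sum_sub_distrib,
      ← Finset.sum_add_distrib]
    refine Finset.sum_congr rfl fun ω _ => ?_
    rcases (hP.1 ω).eq_or_lt with h0 | h0
    · simp [← h0]
    · rw [Real.logb_div (mul_pos (hq0 _ _) (p4 ω h0)).ne' (p1 ω h0).ne',
        Real.logb_mul (hq0 _ _).ne' (p4 ω h0).ne']
      ring
  have l1 : Real.logb 2 (1 - δ) ≤ 0 :=
    Real.logb_nonpos (by norm_num) (by linarith) (by linarith)
  have l2 : Real.logb 2 δ ≤ 0 := Real.logb_nonpos (by norm_num) hδ.le hδ1.le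
  have l3 : 0 ≤ Real.logb 2 k := Real.logb_nonneg (by norm_num) hk
  have lower : Real.logb 2 (1 - δ) - ε * (Real.logb 2 k - Real.logb 2 δ)
      ≤ ∑ ω, P ω * Real.logb 2 (q (M ω) (Y ω)) := by
    calc _ ≤ Real.logb 2 (1 - δ) -
            (∑ ω, P ω * (if g (Y ω) = M ω then 0 else 1)) * (Real.logb 2 k - Real.logb 2 δ) := by
          have := mul_le_mul_of_nonneg_right herr (by linarith : 0 ≤ Real.logb 2 k - Real.logb 2 δ)
          linarith
      _ = ∑ ω, (P ω * Real.logb 2 (1 - δ) -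
            P ω * (if g (Y ω) = M ω then 0 else 1) * (Real.logb 2 k - Real.logb 2 δ)) := by
          rw [Finset.sum_sub_distrib, ← Finset.sum_mul, ← Finset.sum_mul, hP.2, one_mul]
      _ ≤ _ := by
          refine Finset.sum_le_sum fun ω _ => ?_
          have hp := hP.1 ω
          simp only [hq]
          split_ifs
          · simp
          · rw [Real.logb_div hδ.ne' hk0.ne']
            nlinarith
  rw [e] at gg
  linarith

end Ent

section Coord

theorem coord_sum {n : ℕ} {Z : Type} [Fintype Z] (w : Fin n → Z → ℝ) (i : Fin n)
    (hw : ∑ z, w i z = 1) (h : (Fin n → Z) → ℝ)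
    (hh : ∀ z z', (∀ j, j ≠ i → z j = z' j) → h z = h z') (c : Z) :
    ∑ z : Fin n → Z, (∏ t, w t (z t)) * (h z * if z i = c then 1 else 0)
      = w i c * ∑ z : Fin n → Z, (∏ t, w t (z t)) * h z := by
  have e1 : ∀ F : (Fin n → Z) → ℝ, ∑ z, F z
      = ∑ r : {j // j ≠ i} → Z, ∑ a : Z, F ((Equiv.funSplitAt i Z).symm (a, r)) := by
    intro F
    rw [← Fintype.sum_prod_type_right']
    exact (Equiv.sum_comp (Equiv.funSplitAt i Z).symm F).symm
  have hi : ∀ a (r : {j // j ≠ i} → Z), (Equiv.funSplitAt i Z).symm (a, r) i = a := by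
    intro a r; simp [Equiv.funSplitAt, Equiv.piSplitAt]
  have hj : ∀ a (r : {j // j ≠ i} → Z) j (hj : j ≠ i),
      (Equiv.funSplitAt i Z).symm (a, r) j = r ⟨j, hj⟩ := by
    intro a r j hj; simp [Equiv.funSplitAt, Equiv.piSplitAt, hj]
  have hp : ∀ a (r : {j // j ≠ i} → Z), ∏ t, w t ((Equiv.funSplitAt i Z).symm (a, r) t)
      = w i a * ∏ t : {j // j ≠ i}, w t (r t) := by
    intro a r
    rw [Fintype.prod_eq_mul_prod_subtype_ne _ i, hi]
    congr 1
    exact Finset.prod_congr rfl fun t _ => by rw [hj a r t.1 t.2]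
  rw [e1, e1, Finset.mul_sum]
  refine Finset.sum_congr rfl fun r _ => ?_
  have hc : ∀ a, h ((Equiv.funSplitAt i Z).symm (a, r))
      = h ((Equiv.funSplitAt i Z).symm (c, r)) := fun a =>
    hh _ _ fun j hji => by rw [hj a r j hji, hj c r j hji]
  simp only [hp, hi, hc]
  rw [Finset.sum_eq_single c]
  · have : ∑ x, w i x * (∏ t : {j // j ≠ i}, w t (r t)) * h ((Equiv.funSplitAt i Z).symm (c, r))
        = (∑ x, w i x) * ((∏ t : {j // j ≠ i}, w t (r t)) *
          h ((Equiv.funSplitAt i Z).symm (c, r))) := by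
      rw [Finset.sum_mul]; exact Finset.sum_congr rfl fun x _ => by ring
    rw [this, hw]; simp; ring
  · intro b _ hb; simp [hb]
  · simp

variable {X Y1 Y2 : Type} [Fintype X] [Fintype Y1] [Fintype Y2]

theorem sum_pairfun {n : ℕ} (F : (Fin n → Y1) × (Fin n → Y2) → ℝ) :
    ∑ y, F y = ∑ z : Fin n → Y1 × Y2, F (fun t => (z t).1, fun t => (z t).2) :=
  (Equiv.sum_comp (Equiv.arrowProdEquivProdArrow (Fin n) (fun _ => Y1) (fun _ => Y2)) F).symm

theorem sum_prod_fun {n : ℕ} {Z : Type} [Fintype Z] (w : Fin n → Z → ℝ) :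
    ∑ z : Fin n → Z, ∏ t, w t (z t) = ∏ t, ∑ a, w t a := by
  rw [Finset.prod_univ_sum]; simp

theorem nFold_nonneg {W : X → Y1 × Y2 → ℝ} (hW : IsChannel W) (n : ℕ) (x y) :
    0 ≤ nFold W n x y := Finset.prod_nonneg fun _ _ => (hW _).1 _

theorem nFold_sum {W : X → Y1 × Y2 → ℝ} (hW : IsChannel W) (n : ℕ) (x) :
    ∑ y, nFold W n x y = 1 := by
  rw [sum_pairfun]
  unfold nFold
  rw [sum_prod_fun (fun t z => W (x t) z)]
  exact Finset.prod_eq_one fun t _ => (hW _).2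

theorem nFold_marg1 {W : X → Y1 × Y2 → ℝ} (n : ℕ) (x) (y1 : Fin n → Y1) :
    ∑ y2, nFold W n x (y1, y2) = ∏ t, margW1 W (x t) (y1 t) := by
  unfold nFold margW1
  exact sum_prod_fun (fun t y2 => W (x t) (y1 t, y2))

theorem nFold_marg2 {W : X → Y1 × Y2 → ℝ} (n : ℕ) (x) (y2 : Fin n → Y2) :
    ∑ y1, nFold W n x (y1, y2) = ∏ t, margW2 W (x t) (y2 t) := by
  unfold nFold margW2
  exact sum_prod_fun (fun t y1 => W (x t) (y1, y2 t))

end Coord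

section Markov
variable {Ω V X Y1 Y2 Y : Type} [Fintype Ω] [Fintype V] [Fintype X] [Fintype Y1] [Fintype Y2]
  [Fintype Y]

theorem mk1 {P : Ω → ℝ} {W : X → Y1 × Y2 → ℝ} {A : Ω → V} {B : Ω → X} {C1 : Ω → Y1} {C2 : Ω → Y2}
    (h : ∀ v x c, pr P (fun ω => (A ω, B ω, (C1 ω, C2 ω))) (v, x, c)
      = pr P (fun ω => (A ω, B ω)) (v, x) * W x c) (v x y) :
    pr P (fun ω => (A ω, B ω, C1 ω)) (v, x, y)
      = pr P (fun ω => (A ω, B ω)) (v, x) * margW1 W x y := by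
  unfold margW1
  rw [Finset.mul_sum]
  simp only [← h]
  unfold pr
  rw [Finset.sum_comm]
  refine Finset.sum_congr rfl fun ω _ => ?_
  by_cases h1 : A ω = v <;> by_cases h2 : B ω = x <;> by_cases h3 : C1 ω = y <;> simp [h1, h2, h3]

theorem mk2 {P : Ω → ℝ} {W : X → Y1 × Y2 → ℝ} {A : Ω → V} {B : Ω → X} {C1 : Ω → Y1} {C2 : Ω → Y2}
    (h : ∀ v x c, pr P (fun ω => (A ω, B ω, (C1 ω, C2 ω))) (v, x, c)
      = pr P (fun ω => (A ω, B ω)) (v, x) * W x c) (v x y) :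
    pr P (fun ω => (A ω, B ω, C2 ω)) (v, x, y)
      = pr P (fun ω => (A ω, B ω)) (v, x) * margW2 W x y := by
  unfold margW2
  rw [Finset.mul_sum]
  simp only [← h]
  unfold pr
  rw [Finset.sum_comm]
  refine Finset.sum_congr rfl fun ω _ => ?_
  by_cases h1 : A ω = v <;> by_cases h2 : B ω = x <;> by_cases h3 : C2 ω = y <;> simp [h1, h2, h3]

theorem IVY_eq {P : Ω → ℝ} {Wm : X → Y → ℝ} {A : Ω → V} {B : Ω → X} {C : Ω → Y}
    (h : ∀ v x c, pr P (fun ω => (A ω, B ω, C ω)) (v, x, c)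
      = pr P (fun ω => (A ω, B ω)) (v, x) * Wm x c) :
    IVY Wm (pr P (fun ω => (A ω, B ω))) = HR P A + HR P C - HR P (fun ω => (A ω, C ω)) := by
  have e : (fun a : V × Y => ∑ x, pr P (fun ω => (A ω, B ω)) (a.1, x) * Wm x a.2)
      = pr P (fun ω => (A ω, C ω)) := by
    funext ⟨v, y⟩
    simp only [← h]
    unfold pr
    rw [Finset.sum_comm]
    refine Finset.sum_congr rfl fun ω _ => ?_
    by_cases h1 : A ω = v <;> by_cases h3 : C ω = y <;> simp [h1, h3]
  unfold IVY MI
  rw [e]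
  simp only [sum_pr_left, sum_pr_right]
  rw [← Hent_pr, ← Hent_pr, ← Hent_pr]

theorem IXYgV_eq {P : Ω → ℝ} (hP : IsPMF P) {Wm : X → Y → ℝ} {A : Ω → V} {B : Ω → X} {C : Ω → Y}
    (h : ∀ v x c, pr P (fun ω => (A ω, B ω, C ω)) (v, x, c)
      = pr P (fun ω => (A ω, B ω)) (v, x) * Wm x c) :
    IXYgV Wm (pr P (fun ω => (A ω, B ω))) = HR P (fun ω => (A ω, B ω)) + HR P (fun ω => (A ω, C ω))
      - HR P (fun ω => (A ω, B ω, C ω)) - HR P A := by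
  have e : (fun a : X × Y × V => pr P (fun ω => (A ω, B ω)) (a.2.2, a.1) * Wm a.1 a.2.1)
      = pr P (fun ω => (B ω, C ω, A ω)) := by
    funext ⟨x, y, v⟩
    simp only [← h]
    unfold pr
    refine Finset.sum_congr rfl fun ω _ => ?_
    by_cases h1 : A ω = v <;> by_cases h3 : C ω = y <;> by_cases h2 : B ω = x <;> simp [h1, h3, h2]
  unfold IXYgV CMI
  rw [e]
  have e1 : (fun ac : X × V => ∑ b, pr P (fun ω => (B ω, C ω, A ω)) (ac.1, b, ac.2))
      = pr P (fun ω => (B ω, A ω)) := by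
    funext ⟨x, v⟩
    unfold pr
    rw [Finset.sum_comm]
    refine Finset.sum_congr rfl fun ω _ => ?_
    by_cases h1 : A ω = v <;> by_cases h3 : B ω = x <;> simp [h1, h3]
  have e2 : (fun bc : Y × V => ∑ a, pr P (fun ω => (B ω, C ω, A ω)) (a, bc.1, bc.2))
      = pr P (fun ω => (C ω, A ω)) := by
    funext ⟨y, v⟩
    exact sum_pr_left P B (fun ω => (C ω, A ω)) (y, v)
  have e3 : (fun c : V => ∑ a, ∑ b, pr P (fun ω => (B ω, C ω, A ω)) (a, b, c)) = pr P A := by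
    funext v
    rw [← sum_pr_left P B A v]
    exact Finset.sum_congr rfl fun a _ => congrFun e1 (a, v)
  rw [e1, e2, e3]
  simp only [Hent_pr]
  rw [HR_congr hP.1 (A := fun ω => (A ω, B ω)) (B := fun ω => (B ω, A ω))
      (fun ω ω' => by simp only [Prod.mk.injEq]; tauto),
    HR_congr hP.1 (A := fun ω => (A ω, C ω)) (B := fun ω => (C ω, A ω))
      (fun ω ω' => by simp only [Prod.mk.injEq]; tauto),
    HR_congr hP.1 (A := fun ω => (A ω, B ω, C ω)) (B := fun ω => (B ω, C ω, A ω))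
      (fun ω ω' => by simp only [Prod.mk.injEq]; tauto)]

theorem HR_W {P : Ω → ℝ} (hP : IsPMF P) {Wm : X → Y → ℝ} {A : Ω → V} {B : Ω → X} {C : Ω → Y}
    (h : ∀ v x c, pr P (fun ω => (A ω, B ω, C ω)) (v, x, c)
      = pr P (fun ω => (A ω, B ω)) (v, x) * Wm x c) :
    HR P (fun ω => (A ω, B ω, C ω)) - HR P (fun ω => (A ω, B ω))
      = -∑ ω, P ω * Real.logb 2 (Wm (B ω) (C ω)) := by
  unfold HR
  rw [sub_neg_eq_add, neg_add_eq_sub, ← Finset.sum_sub_distrib, ← Finset.sum_neg_distrib]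
  refine Finset.sum_congr rfl fun ω _ => ?_
  rcases (hP.1 ω).eq_or_lt with h0 | h0
  · simp [← h0]
  · have h1 := h0.trans_le (le_pr hP.1 (fun ω => (A ω, B ω, C ω)) ω)
    have h2 := h0.trans_le (le_pr hP.1 (fun ω => (A ω, B ω)) ω)
    simp only at h1 h2 ⊢
    rw [h] at h1 ⊢
    have h3 : Wm (B ω) (C ω) ≠ 0 := by rintro h4; rw [h4, mul_zero] at h1; exact lt_irrefl _ h1
    rw [Real.logb_mul h2.ne' h3]; ring

/-- Uniform time-sharing extension of a finite probability space. -/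
def tsP (n : ℕ) (P : Ω → ℝ) : Fin n × Ω → ℝ := fun t => P t.2 / n

theorem isPMF_tsP {n : ℕ} (hn : 0 < n) {P : Ω → ℝ} (hP : IsPMF P) : IsPMF (tsP n P) := by
  refine ⟨fun t => div_nonneg (hP.1 _) (by positivity), ?_⟩
  unfold tsP
  rw [Fintype.sum_prod_type]
  simp only [← Finset.sum_div, hP.2]
  have : (n : ℝ) ≠ 0 := by positivity
  simp [this]

theorem pr_tsP {n : ℕ} (P : Ω → ℝ) (A : Fin n → Ω → V) (i : Fin n) (v : V) :
    pr (tsP n P) (fun t => (t.1, A t.1 t.2)) (i, v) = pr P (A i) v / n := by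
  unfold pr tsP
  rw [Fintype.sum_prod_type, Finset.sum_eq_single i]
  · rw [Finset.sum_div]
    refine Finset.sum_congr rfl fun ω _ => ?_
    by_cases h : A i ω = v <;> simp [h]
  · intro j _ hj; simp [hj]
  · simp

theorem HR_tsP {n : ℕ} (hn : 0 < n) {P : Ω → ℝ} (hP : IsPMF P) (A : Fin n → Ω → V) :
    HR (tsP n P) (fun t => (t.1, A t.1 t.2))
      = Real.logb 2 n + (∑ i, HR P (A i)) / n := by
  have hn' : (n : ℝ) ≠ 0 := by positivity
  unfold HR
  simp only [pr_tsP]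
  rw [Fintype.sum_prod_type]
  have : ∀ i : Fin n, ∑ ω, tsP n P (i, ω) * Real.logb 2 (pr P (A i) (A i ω) / n)
      = (∑ ω, P ω * Real.logb 2 (pr P (A i) (A i ω))) / n - Real.logb 2 n / n := by
    intro i
    have e : Real.logb 2 n / n = ∑ ω, P ω * (Real.logb 2 n / n) := by
      rw [← Finset.sum_mul, hP.2, one_mul]
    rw [e, Finset.sum_div, ← Finset.sum_sub_distrib]
    refine Finset.sum_congr rfl fun ω _ => ?_
    unfold tsP
    rcases (hP.1 ω).eq_or_lt with h0 | h0
    · simp [← h0]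
    · rw [Real.logb_div (h0.trans_le (le_pr hP.1 (A i) ω)).ne' hn']
      ring
  simp only [this]
  rw [Finset.sum_sub_distrib, Finset.sum_neg_distrib, ← Finset.sum_div]
  simp
  field_simp
  ring

end Markov

section Conv
variable {X Y1 Y2 : Type} [Fintype X] [Fintype Y1] [Fintype Y2]

/-- Joint law of messages and outputs induced by a code. -/
def codeP (W : X → Y1 × Y2 → ℝ) (n k1 k2 : ℕ) (f : Fin k1 × Fin k2 → Fin n → X) :
    (Fin k1 × Fin k2) × ((Fin n → Y1) × (Fin n → Y2)) → ℝ :=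
  fun ω => nFold W n (f ω.1) ω.2 / ((k1 : ℝ) * (k2 : ℝ))

/-- Sample space of the converse. -/
abbrev Om (Y1 Y2 : Type) (n k1 k2 : ℕ) : Type :=
  (Fin k1 × Fin k2) × ((Fin n → Y1) × (Fin n → Y2))

/-- The auxiliary variable of the converse at time `i`. -/
def auxV {n k1 k2 : ℕ} (i : Fin n) (ω : (Fin k1 × Fin k2) × ((Fin n → Y1) × (Fin n → Y2))) :
    Fin k2 × (Fin n → Option (Y1 ⊕ Y2)) :=
  (ω.1.2, fun j => if j < i then some (Sum.inr (ω.2.2 j))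
    else if i < j then some (Sum.inl (ω.2.1 j)) else none)

theorem isPMF_codeP {W : X → Y1 × Y2 → ℝ} (hW : IsChannel W) {n k1 k2 : ℕ} (hk1 : 0 < k1)
    (hk2 : 0 < k2) (f : Fin k1 × Fin k2 → Fin n → X) : IsPMF (codeP W n k1 k2 f) := by
  refine ⟨fun ω => div_nonneg (nFold_nonneg hW _ _ _) (by positivity), ?_⟩
  unfold codeP
  rw [Fintype.sum_prod_type]
  simp only [← Finset.sum_div, nFold_sum hW]
  have h1 : (k1 : ℝ) ≠ 0 := by positivity
  have h2 : (k2 : ℝ) ≠ 0 := by positivity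
  simp [h1, h2]

theorem code_markov {W : X → Y1 × Y2 → ℝ} (hW : IsChannel W) {n k1 k2 : ℕ}
    (f : Fin k1 × Fin k2 → Fin n → X) (i : Fin n) (v x c) :
    pr (codeP W n k1 k2 f) (fun ω => (auxV i ω, f ω.1 i, (ω.2.1 i, ω.2.2 i))) (v, x, c)
      = pr (codeP W n k1 k2 f) (fun ω => (auxV i ω, f ω.1 i)) (v, x) * W x c := by
  have hs : ∀ F : (Fin k1 × Fin k2) × ((Fin n → Y1) × (Fin n → Y2)) → ℝ,
      ∑ ω, F ω = ∑ m, ∑ y, F (m, y) := fun F => Fintype.sum_prod_type F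
  unfold pr
  rw [hs, hs, Finset.sum_mul]
  refine Finset.sum_congr rfl fun m _ => ?_
  by_cases hx : f m i = x
  swap
  · simp [hx]
  rw [sum_pairfun, sum_pairfun]
  have key := coord_sum (fun t z => W (f m t) z) i ((hW _).2)
    (fun z : Fin n → Y1 × Y2 => if auxV (k1 := k1) (k2 := k2) i
      (m, (fun t => (z t).1, fun t => (z t).2)) = v then ((k1 : ℝ) * (k2 : ℝ))⁻¹ else 0)
    (fun z z' hz => by
      have : auxV (k1 := k1) (k2 := k2) i (m, (fun t => (z t).1, fun t => (z t).2))
        = auxV (k1 := k1) (k2 := k2) i (m, (fun t => (z' t).1, fun t => (z' t).2)) := by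
        unfold auxV
        congr 1
        funext j
        by_cases hj : j = i
        · subst hj; simp
        · simp [hz j hj]
      rw [this]) c
  subst hx
  rw [mul_comm (W (f m i) c)] at key
  convert key using 1
  · refine Finset.sum_congr rfl fun z _ => ?_
    unfold codeP nFold
    by_cases h1 : auxV (k1 := k1) (k2 := k2) i (m, (fun t => (z t).1, fun t => (z t).2)) = v
    · by_cases h2 : z i = c
      · simp [h1, h2, div_eq_mul_inv]
      · have : ¬ ((z i).1, (z i).2) = c := h2
        simp [h1, h2]
    · simp [h1]
  · congr 1
    refine Finset.sum_congr rfl fun z _ => ?_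
    unfold codeP nFold
    by_cases h1 : auxV (k1 := k1) (k2 := k2) i (m, (fun t => (z t).1, fun t => (z t).2)) = v
    · simp [h1, div_eq_mul_inv]
    · simp [h1]

theorem HR_M2 {W : X → Y1 × Y2 → ℝ} (hW : IsChannel W) {n k1 k2 : ℕ} (hk1 : 0 < k1)
    (hk2 : 0 < k2) (f : Fin k1 × Fin k2 → Fin n → X) :
    HR (codeP W n k1 k2 f) (fun ω => ω.1.2) = Real.logb 2 k2 := by
  have h1 : (k1 : ℝ) ≠ 0 := by positivity
  have h2 : (k2 : ℝ) ≠ 0 := by positivity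
  have e : ∀ b : Fin k2, pr (codeP W n k1 k2 f) (fun ω => ω.1.2) b = (k2 : ℝ)⁻¹ := by
    intro b
    unfold pr codeP
    rw [Fintype.sum_prod_type, Fintype.sum_prod_type]
    have : ∀ a : Fin k1, ∀ b' : Fin k2, (∑ y, if b' = b then nFold W n (f (a, b')) y / ((k1 : ℝ) * k2)
        else 0) = if b' = b then ((k1 : ℝ) * k2)⁻¹ else 0 := by
      intro a b'
      by_cases h : b' = b
      · simp [h, ← Finset.sum_div, nFold_sum hW]
      · simp [h]
    simp only [this]
    simp
    field_simp
  unfold HR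
  simp only [e]
  rw [← Finset.sum_mul, (isPMF_codeP hW hk1 hk2 f).2, Real.logb_inv]
  ring

theorem HR_M {W : X → Y1 × Y2 → ℝ} (hW : IsChannel W) {n k1 k2 : ℕ} (hk1 : 0 < k1)
    (hk2 : 0 < k2) (f : Fin k1 × Fin k2 → Fin n → X) :
    HR (codeP W n k1 k2 f) (fun ω => ω.1) = Real.logb 2 k1 + Real.logb 2 k2 := by
  have h1 : (k1 : ℝ) ≠ 0 := by positivity
  have h2 : (k2 : ℝ) ≠ 0 := by positivity
  have e : ∀ m, pr (codeP W n k1 k2 f) (fun ω => ω.1) m = ((k1 : ℝ) * k2)⁻¹ := by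
    intro b
    unfold pr codeP
    rw [Fintype.sum_prod_type, Finset.sum_eq_single b]
    · simp [← Finset.sum_div, nFold_sum hW]
    · intro m _ hm; simp [hm]
    · simp
  unfold HR
  simp only [e]
  rw [← Finset.sum_mul, (isPMF_codeP hW hk1 hk2 f).2, Real.logb_inv, Real.logb_mul h1 h2]
  ring

theorem HR_MY1 {W : X → Y1 × Y2 → ℝ} (hW : IsChannel W) {n k1 k2 : ℕ} (hk1 : 0 < k1)
    (hk2 : 0 < k2) (f : Fin k1 × Fin k2 → Fin n → X) :
    HR (codeP W n k1 k2 f) (fun ω => (ω.1, ω.2.1)) - HR (codeP W n k1 k2 f) (fun ω => ω.1)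
      = ∑ i : Fin n, (HR (codeP W n k1 k2 f) (fun ω => (auxV i ω, f ω.1 i, ω.2.1 i))
          - HR (codeP W n k1 k2 f) (fun ω => (auxV i ω, f ω.1 i))) := by
  have hP := isPMF_codeP hW hk1 hk2 f
  have h1 : (k1 : ℝ) ≠ 0 := by positivity
  have h2 : (k2 : ℝ) ≠ 0 := by positivity
  have e : ∀ i : Fin n, HR (codeP W n k1 k2 f) (fun ω => (auxV i ω, f ω.1 i, ω.2.1 i))
          - HR (codeP W n k1 k2 f) (fun ω => (auxV i ω, f ω.1 i))
        = -∑ ω, codeP W n k1 k2 f ω * Real.logb 2 (margW1 W (f ω.1 i) (ω.2.1 i)) := fun i =>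
    HR_W hP (mk1 (C1 := fun ω : Om Y1 Y2 n k1 k2 => ω.2.1 i) (C2 := fun ω => ω.2.2 i) (code_markov hW f i))
  simp only [e]
  have e2 : ∀ m y1, pr (codeP W n k1 k2 f) (fun ω => (ω.1, ω.2.1)) (m, y1)
      = ((k1 : ℝ) * k2)⁻¹ * ∏ t, margW1 W (f m t) (y1 t) := by
    intro m y1
    rw [← nFold_marg1]
    unfold pr codeP
    rw [Fintype.sum_prod_type, Finset.sum_eq_single m]
    · rw [Fintype.sum_prod_type, Finset.sum_eq_single y1]
      · simp [← Finset.sum_div]; ring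
      · intro y _ hy; simp [hy]
      · simp
    · intro y _ hy; simp [hy]
    · simp
  rw [HR_M hW hk1 hk2 f]
  unfold HR
  simp only [e2]
  have e3 : ∀ ω, codeP W n k1 k2 f ω * Real.logb 2 (((k1 : ℝ) * k2)⁻¹ *
      ∏ t, margW1 W (f ω.1 t) (ω.2.1 t)) = codeP W n k1 k2 f ω *
      -(Real.logb 2 k1 + Real.logb 2 k2) + ∑ t, codeP W n k1 k2 f ω *
        Real.logb 2 (margW1 W (f ω.1 t) (ω.2.1 t)) := by
    intro ω
    rcases (hP.1 ω).eq_or_lt with h0 | h0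
    · simp [← h0]
    · have h3 := h0.trans_le (le_pr hP.1 (fun ω => (ω.1, ω.2.1)) ω)
      rw [e2] at h3
      have h4 : ∏ t, margW1 W (f ω.1 t) (ω.2.1 t) ≠ 0 := by
        intro h; rw [h, mul_zero] at h3; exact lt_irrefl _ h3
      rw [Real.logb_mul (by positivity) h4, Real.logb_inv, Real.logb_mul h1 h2,
        Real.logb_prod _ _ (fun t _ => (Finset.prod_ne_zero_iff.1 h4) t (Finset.mem_univ t)),
        ← Finset.mul_sum]
      ring
  simp only [e3]
  rw [Finset.sum_add_distrib, ← Finset.sum_mul, hP.2, Finset.sum_comm, Finset.sum_neg_distrib]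
  ring

theorem tele {n : ℕ} (G : ℕ → ℝ) : ∑ i : Fin n, (G (i + 1) - G i) = G n - G 0 := by
  rw [Fin.sum_univ_eq_sum_range (fun i => G (i + 1) - G i), Finset.sum_range_sub]

theorem HR_Y2_le {W : X → Y1 × Y2 → ℝ} (hW : IsChannel W) {n k1 k2 : ℕ} (hk1 : 0 < k1)
    (hk2 : 0 < k2) (f : Fin k1 × Fin k2 → Fin n → X) :
    HR (codeP W n k1 k2 f) (fun ω => ω.2.2)
      ≤ ∑ i : Fin n, HR (codeP W n k1 k2 f) (fun ω => ω.2.2 i) := by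
  have hP := isPMF_codeP hW hk1 hk2 f
  set P := codeP W n k1 k2 f
  have t := tele (n := n) (fun i => HR P (fun ω (j : Fin n) =>
    if (j : ℕ) < i then some (ω.2.2 j) else none))
  have h0 : HR P (fun ω (j : Fin n) => if (j : ℕ) < 0 then some (ω.2.2 j) else none) = 0 :=
    HR_const hP (by intro ω ω'; funext j; simp)
  have hn : HR P (fun ω (j : Fin n) => if (j : ℕ) < n then some (ω.2.2 j) else none)
      = HR P (fun ω => ω.2.2) := HR_congr hP.1 (by
        intro ω ω'
        simp only [funext_iff]
        simp)
  simp only [h0, hn, sub_zero] at t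
  rw [← t]
  refine Finset.sum_le_sum fun i _ => ?_
  have s := HR_submod hP (fun ω => ω.2.2 i)
    (fun ω (j : Fin n) => if (j : ℕ) < i then some (ω.2.2 j) else none) (fun _ => ())
  have c0 : HR P (fun _ => ()) = 0 := HR_const hP (by simp)
  have c1 : HR P (fun ω => (ω.2.2 i, ())) = HR P (fun ω => ω.2.2 i) :=
    HR_congr hP.1 (by simp)
  have c2 : HR P (fun ω => ((fun (j : Fin n) => if (j : ℕ) < i then some (ω.2.2 j) else none), ()))
      = HR P (fun ω (j : Fin n) => if (j : ℕ) < i then some (ω.2.2 j) else none) :=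
    HR_congr hP.1 (by simp)
  have c3 : HR P (fun ω (j : Fin n) => if (j : ℕ) < i + 1 then some (ω.2.2 j) else none) ≤
    HR P (fun ω => (ω.2.2 i,
      (fun (j : Fin n) => if (j : ℕ) < i then some (ω.2.2 j) else none), ())) :=
    HR_mono hP.1 (by
      intro ω ω' h
      simp only [Prod.mk.injEq, funext_iff] at h
      funext j
      have hj := h.2.1 j
      by_cases h1 : (j : ℕ) < i
      · simp only [h1, if_true] at hj
        simp [show (j : ℕ) < i + 1 by omega, hj] at hj ⊢
      · by_cases h2 : j = i
        · subst h2; simp [h.1]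
        · have : ¬ (j : ℕ) < i + 1 := by
            have : (j : ℕ) ≠ i := fun h => h2 (Fin.ext h)
            omega
          simp [this])
  linarith

theorem HR_Y2M2_ge {W : X → Y1 × Y2 → ℝ} (hW : IsChannel W) {n k1 k2 : ℕ} (hk1 : 0 < k1)
    (hk2 : 0 < k2) (f : Fin k1 × Fin k2 → Fin n → X) :
    ∑ i : Fin n, (HR (codeP W n k1 k2 f) (fun ω => (auxV i ω, ω.2.2 i))
        - HR (codeP W n k1 k2 f) (fun ω => auxV i ω))
    ≤ HR (codeP W n k1 k2 f) (fun ω => (ω.1.2, ω.2.2)) - HR (codeP W n k1 k2 f) (fun ω => ω.1.2)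
      := by
  have hP := isPMF_codeP hW hk1 hk2 f
  set P := codeP W n k1 k2 f
  have t := tele (n := n) (fun i => HR P (fun ω => (ω.1.2, fun (j : Fin n) =>
    if (j : ℕ) < i then some (ω.2.2 j) else none)))
  have h0 : HR P (fun ω => (ω.1.2, fun (j : Fin n) => if (j : ℕ) < 0 then some (ω.2.2 j) else none))
      = HR P (fun ω => ω.1.2) := HR_congr hP.1 (by intro ω ω'; simp)
  have hn : HR P (fun ω => (ω.1.2, fun (j : Fin n) => if (j : ℕ) < n then some (ω.2.2 j) else none))
      = HR P (fun ω => (ω.1.2, ω.2.2)) := HR_congr hP.1 (by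
        intro ω ω'
        simp only [Prod.mk.injEq, funext_iff]
        simp)
  simp only [h0, hn] at t
  rw [← t]
  refine Finset.sum_le_sum fun i _ => ?_
  have s := HR_submod hP (fun ω => ω.2.2 i) (fun ω => auxV i ω)
    (fun ω => (ω.1.2, fun (j : Fin n) => if (j : ℕ) < i then some (ω.2.2 j) else none))
  have aux : ∀ ω ω' : Om Y1 Y2 n k1 k2, auxV i ω = auxV i ω' → (fun (j : Fin n) => if (j : ℕ) < i then
      some (ω.2.2 j) else none) = (fun (j : Fin n) => if (j : ℕ) < i then
      some (ω'.2.2 j) else none) := by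
    intro ω ω' h
    unfold auxV at h
    simp only [Prod.mk.injEq, funext_iff] at h
    funext j
    have hj := h.2 j
    by_cases h1 : j < i
    · have h1' : (j : ℕ) < i := h1
      simp only [h1, if_true, Option.some.injEq, Sum.inr.injEq] at hj
      simp [hj]
    · have h1' : ¬ (j : ℕ) < i := h1
      simp [h1]
  have aux2 : ∀ ω ω' : Om Y1 Y2 n k1 k2, auxV i ω = auxV i ω' → ω.1.2 = ω'.1.2 := by
    intro ω ω' h
    exact congrArg Prod.fst h
  have c1 : HR P (fun ω => (auxV i ω, ω.2.2 i)) = HR P (fun ω => (ω.2.2 i, auxV i ω,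
      (ω.1.2, fun (j : Fin n) => if (j : ℕ) < i then some (ω.2.2 j) else none))) :=
    HR_congr hP.1 (by
      intro ω ω'
      simp only [Prod.mk.injEq]
      constructor
      · rintro ⟨h1, h2, h3⟩; exact ⟨h2, h1⟩
      · rintro ⟨h1, h2⟩; exact ⟨h2, h1, aux2 _ _ h1, aux _ _ h1⟩)
  have c2 : HR P (fun ω => auxV i ω) = HR P (fun ω => (auxV i ω,
      (ω.1.2, fun (j : Fin n) => if (j : ℕ) < i then some (ω.2.2 j) else none))) :=
    HR_congr hP.1 (by
      intro ω ω'
      simp only [Prod.mk.injEq]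
      constructor
      · rintro ⟨h1, _⟩; exact h1
      · rintro h1; exact ⟨h1, aux2 _ _ h1, aux _ _ h1⟩)
  have c3 : HR P (fun ω => (ω.2.2 i, (ω.1.2, fun (j : Fin n) => if (j : ℕ) < i then
      some (ω.2.2 j) else none))) = HR P (fun ω => (ω.1.2, fun (j : Fin n) =>
        if (j : ℕ) < i + 1 then some (ω.2.2 j) else none)) :=
    HR_congr hP.1 (by
      intro ω ω'
      simp only [Prod.mk.injEq, funext_iff]
      constructor
      · rintro ⟨h1, h2⟩
        refine ⟨?_, h1, fun j => ?_⟩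
        · simpa using h2 i
        · have := h2 j
          by_cases hj : (j : ℕ) < i
          · simpa [hj, show (j : ℕ) < i + 1 by omega] using this
          · simp [hj]
      · rintro ⟨h1, h2, h3⟩
        refine ⟨h2, fun j => ?_⟩
        have := h3 j
        by_cases hj : (j : ℕ) < i
        · simpa [hj, show (j : ℕ) < i + 1 by omega] using this
        · by_cases hji : j = i
          · subst hji; simp [h1]
          · have : ¬ (j : ℕ) < i + 1 := by
              have : (j : ℕ) ≠ i := fun h => hji (Fin.ext h)
              omega
            simp [this])
  linarith

theorem HR_swap {W : X → Y1 × Y2 → ℝ} (hW : IsChannel W) {n k1 k2 : ℕ} (hk1 : 0 < k1)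
    (hk2 : 0 < k2) (f : Fin k1 × Fin k2 → Fin n → X) :
    HR (codeP W n k1 k2 f) (fun ω => (ω.1.2, ω.2.2))
      - HR (codeP W n k1 k2 f) (fun ω => (ω.1.2, ω.2.1))
    = ∑ i : Fin n, (HR (codeP W n k1 k2 f) (fun ω => (auxV i ω, ω.2.2 i))
        - HR (codeP W n k1 k2 f) (fun ω => (auxV i ω, ω.2.1 i))) := by
  have hP := isPMF_codeP hW hk1 hk2 f
  set P := codeP W n k1 k2 f
  have t := tele (n := n) (fun i => HR P (fun ω => (ω.1.2, fun (j : Fin n) =>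
    if (j : ℕ) < i then Sum.inr (ω.2.2 j) else Sum.inl (ω.2.1 j))))
  have h0 : HR P (fun ω => (ω.1.2, fun (j : Fin n) =>
      if (j : ℕ) < 0 then Sum.inr (ω.2.2 j) else Sum.inl (ω.2.1 j)))
      = HR P (fun ω => (ω.1.2, ω.2.1)) := HR_congr hP.1 (by
        intro ω ω'
        simp only [Prod.mk.injEq, funext_iff]
        simp)
  have hn : HR P (fun ω => (ω.1.2, fun (j : Fin n) =>
      if (j : ℕ) < n then Sum.inr (ω.2.2 j) else Sum.inl (ω.2.1 j)))
      = HR P (fun ω => (ω.1.2, ω.2.2)) := HR_congr hP.1 (by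
        intro ω ω'
        simp only [Prod.mk.injEq, funext_iff]
        simp)
  simp only [h0, hn] at t
  rw [← t]
  refine Finset.sum_congr rfl fun i _ => ?_
  have c1 : HR P (fun ω => (ω.1.2, fun (j : Fin n) =>
      if (j : ℕ) < i then Sum.inr (ω.2.2 j) else Sum.inl (ω.2.1 j)))
      = HR P (fun ω => (auxV i ω, ω.2.1 i)) := HR_congr hP.1 (by
        intro ω ω'
        unfold auxV
        simp only [Prod.mk.injEq, funext_iff]
        constructor
        · rintro ⟨⟨h1, h2⟩, h3⟩
          refine ⟨h1, fun j => ?_⟩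
          have := h2 j
          rcases lt_trichotomy j i with hj | hj | hj
          · have hj' : (j : ℕ) < i := hj
            simpa [hj] using this
          · subst hj; simpa using h3
          · have hj' : ¬ j < i := not_lt.2 hj.le
            simpa [hj, hj'] using this
        · rintro ⟨h1, h2⟩
          refine ⟨⟨h1, fun j => ?_⟩, ?_⟩
          · have := h2 j
            rcases lt_trichotomy j i with hj | hj | hj
            · have hj' : (j : ℕ) < i := hj
              simpa [hj] using this
            · subst hj; simp
            · have hj' : ¬ j < i := not_lt.2 hj.le
              simpa [hj, hj'] using this
          · simpa using h2 i)
  have c2 : HR P (fun ω => (ω.1.2, fun (j : Fin n) =>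
      if (j : ℕ) < i + 1 then Sum.inr (ω.2.2 j) else Sum.inl (ω.2.1 j)))
      = HR P (fun ω => (auxV i ω, ω.2.2 i)) := HR_congr hP.1 (by
        intro ω ω'
        unfold auxV
        simp only [Prod.mk.injEq, funext_iff]
        constructor
        · rintro ⟨⟨h1, h2⟩, h3⟩
          refine ⟨h1, fun j => ?_⟩
          have := h2 j
          rcases lt_trichotomy j i with hj | hj | hj
          · have hj' : (j : ℕ) < i + 1 := Nat.lt_succ_of_lt hj
            simpa [hj, hj'] using this
          · subst hj; simpa using h3
          · have hj' : ¬ j < i := not_lt.2 hj.le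
            have hj2 : ¬ (j : ℕ) < i + 1 := by
              have : (i : ℕ) < j := hj
              omega
            simpa [hj, hj', hj2] using this
        · rintro ⟨h1, h2⟩
          refine ⟨⟨h1, fun j => ?_⟩, ?_⟩
          · have := h2 j
            rcases lt_trichotomy j i with hj | hj | hj
            · have hj' : (j : ℕ) < i + 1 := Nat.lt_succ_of_lt hj
              simpa [hj, hj'] using this
            · subst hj; simp
            · have hj' : ¬ j < i := not_lt.2 hj.le
              have hj2 : ¬ (j : ℕ) < i + 1 := by
                have : (i : ℕ) < j := hj
                omega
              simpa [hj, hj', hj2] using this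
          · simpa using h2 i)
  rw [c1, c2]

end Conv

section Conv2
variable {X Y1 Y2 : Type} [Fintype X] [Fintype Y1] [Fintype Y2]

theorem ts_markov {Ω V C : Type} [Fintype Ω] [Fintype V] [Fintype C] {n k : ℕ} {P : Ω → ℝ}
    {W : X → C → ℝ} {A : Fin n → Ω → V} {B : Fin n → Ω → X} {D : Fin n → Ω → C}
    (e : Fin n × V ≃ Fin k)
    (h : ∀ i v x c, pr P (fun ω => (A i ω, B i ω, D i ω)) (v, x, c)
      = pr P (fun ω => (A i ω, B i ω)) (v, x) * W x c) (w x c) :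
    pr (tsP n P) (fun t => (e (t.1, A t.1 t.2), B t.1 t.2, D t.1 t.2)) (w, x, c)
      = pr (tsP n P) (fun t => (e (t.1, A t.1 t.2), B t.1 t.2)) (w, x) * W x c := by
  obtain ⟨⟨i, v⟩, rfl⟩ := e.surjective w
  have e1 : pr (tsP n P) (fun t => (e (t.1, A t.1 t.2), B t.1 t.2, D t.1 t.2)) (e (i, v), x, c)
      = pr (tsP n P) (fun t => (t.1, (A t.1 t.2, B t.1 t.2, D t.1 t.2))) (i, (v, x, c)) := by
    unfold pr
    refine Finset.sum_congr rfl fun t _ => ?_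
    simp only [Prod.mk.injEq, EmbeddingLike.apply_eq_iff_eq, and_assoc]
  have e2 : pr (tsP n P) (fun t => (e (t.1, A t.1 t.2), B t.1 t.2)) (e (i, v), x)
      = pr (tsP n P) (fun t => (t.1, (A t.1 t.2, B t.1 t.2))) (i, (v, x)) := by
    unfold pr
    refine Finset.sum_congr rfl fun t _ => ?_
    simp only [Prod.mk.injEq, EmbeddingLike.apply_eq_iff_eq, and_assoc]
  rw [e1, e2, pr_tsP P (fun i ω => (A i ω, B i ω, D i ω)), pr_tsP P (fun i ω => (A i ω, B i ω)), h]
  ring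

theorem errP1_eq (W : X → Y1 × Y2 → ℝ) (n k1 k2 : ℕ) (f : Fin k1 × Fin k2 → Fin n → X)
    (g1 : (Fin n → Y1) × Fin k2 → Fin k1) (g2 : (Fin n → Y2) → Fin k2) :
    errP1 W n k1 k2 f g1 g2 = ∑ ω : Om Y1 Y2 n k1 k2, codeP W n k1 k2 f ω *
      (if g1 (ω.2.1, ω.1.2) = ω.1.1 ∧ g2 ω.2.2 = ω.1.2 then 0 else 1) := by
  have hs : ∀ F : Om Y1 Y2 n k1 k2 → ℝ,
      ∑ ω, F ω = ∑ m, ∑ y, F (m, y) := fun F => Fintype.sum_prod_type F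
  unfold errP1 codeP
  rw [hs, Finset.mul_sum]
  refine Finset.sum_congr rfl fun m _ => ?_
  rw [Finset.mul_sum]
  refine Finset.sum_congr rfl fun y _ => ?_
  ring

theorem converse {W : X → Y1 × Y2 → ℝ} (hW : IsChannel W) {n k1 k2 : ℕ} (hn : 0 < n)
    (hk1 : 0 < k1) (hk2 : 0 < k2) (f : Fin k1 × Fin k2 → Fin n → X)
    (g1 : (Fin n → Y1) × Fin k2 → Fin k1) (g2 : (Fin n → Y2) → Fin k2) {δ ε : ℝ}
    (hδ : 0 < δ) (hδ1 : δ < 1) (herr : errP1 W n k1 k2 f g1 g2 ≤ ε) :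
    ∃ (k : ℕ) (q : Fin k × X → ℝ), IsPMF q ∧
      Real.logb 2 k2 ≤ n * IVY (margW2 W) q +
        (-Real.logb 2 (1 - δ) + ε * (Real.logb 2 k2 - Real.logb 2 δ)) ∧
      Real.logb 2 k1 + Real.logb 2 k2 ≤ n * (IXYgV (margW1 W) q + IVY (margW2 W) q) +
        (-Real.logb 2 (1 - δ) + ε * (Real.logb 2 k1 - Real.logb 2 δ)) +
        (-Real.logb 2 (1 - δ) + ε * (Real.logb 2 k2 - Real.logb 2 δ)) := by
  have hP := isPMF_codeP hW hk1 hk2 f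
  rw [errP1_eq] at herr
  have hM2 := HR_M2 hW hk1 hk2 f
  have hM := HR_M hW hk1 hk2 f
  have hMY1 := HR_MY1 hW hk1 hk2 f
  have hY2 := HR_Y2_le hW hk1 hk2 f
  have hYM := HR_Y2M2_ge hW hk1 hk2 f
  have hsw := HR_swap hW hk1 hk2 f
  have hmk := code_markov hW f
  set P := codeP W n k1 k2 f with hPdef
  have F2 := fano hP (fun ω : Om Y1 Y2 n k1 k2 => ω.1.2) (fun ω => ω.2.2) g2 hδ hδ1 (ε := ε) (by
    refine le_trans (Finset.sum_le_sum fun ω _ => ?_) herr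
    refine mul_le_mul_of_nonneg_left ?_ (hP.1 ω)
    by_cases h : g2 ω.2.2 = ω.1.2
    · simp only [h, if_true]; split_ifs <;> norm_num
    · simp [h])
  have F1 := fano hP (fun ω : Om Y1 Y2 n k1 k2 => ω.1.1) (fun ω => (ω.2.1, ω.1.2)) g1 hδ hδ1
    (ε := ε) (by
    refine le_trans (Finset.sum_le_sum fun ω _ => ?_) herr
    refine mul_le_mul_of_nonneg_left ?_ (hP.1 ω)
    by_cases h : g1 (ω.2.1, ω.1.2) = ω.1.1
    · simp only [h, if_true]; split_ifs <;> norm_num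
    · simp [h])
  rw [Fintype.card_fin] at F1 F2
  have c1 : HR P (fun ω => (ω.1.1, (ω.2.1, ω.1.2))) = HR P (fun ω => (ω.1, ω.2.1)) :=
    HR_congr hP.1 (by intro ω ω'; simp only [Prod.mk.injEq, Prod.ext_iff]; tauto)
  have c2 : HR P (fun ω => (ω.2.1, ω.1.2)) = HR P (fun ω => (ω.1.2, ω.2.1)) :=
    HR_congr hP.1 (by intro ω ω'; simp only [Prod.mk.injEq]; tauto)
  rw [c1, c2] at F1
  let V := Fin k2 × (Fin n → Option (Y1 ⊕ Y2))
  let e : Fin n × V ≃ Fin (Fintype.card (Fin n × V)) := Fintype.equivFin _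
  have hPt := isPMF_tsP hn hP
  set T := tsP n P with hT
  let A : Fin n × Om Y1 Y2 n k1 k2 → Fin (Fintype.card (Fin n × V)) := fun t => e (t.1, auxV t.1 t.2)
  let B : Fin n × Om Y1 Y2 n k1 k2 → X := fun t => f t.2.1 t.1
  let C1 : Fin n × Om Y1 Y2 n k1 k2 → Y1 := fun t => t.2.2.1 t.1
  let C2 : Fin n × Om Y1 Y2 n k1 k2 → Y2 := fun t => t.2.2.2 t.1
  have mk : ∀ v x c, pr T (fun ω => (A ω, B ω, (C1 ω, C2 ω))) (v, x, c)
      = pr T (fun ω => (A ω, B ω)) (v, x) * W x c :=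
    ts_markov (A := fun i ω => auxV i ω) (B := fun i ω => f ω.1 i)
      (D := fun i ω => (ω.2.1 i, ω.2.2 i)) e hmk
  have I2 := IVY_eq (mk2 mk)
  have I1 := IXYgV_eq hPt (mk1 mk)
  refine ⟨_, pr T (fun ω => (A ω, B ω)), isPMF_pr hPt _, ?_⟩
  have inj : ∀ a b, e a = e b ↔ a = b := fun a b => e.injective.eq_iff
  have d1 : HR T A = Real.logb 2 n + (∑ i, HR P (fun ω => auxV i ω)) / n := by
    rw [← HR_tsP hn hP]
    exact HR_congr hPt.1 (by intro ω ω'; simp only [A, inj])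
  have d2 : HR T (fun ω => (A ω, C2 ω))
      = Real.logb 2 n + (∑ i, HR P (fun ω => (auxV i ω, ω.2.2 i))) / n := by
    rw [← HR_tsP hn hP (fun i ω => (auxV i ω, ω.2.2 i))]
    exact HR_congr hPt.1 (by intro ω ω'; simp only [A, C2, inj, Prod.mk.injEq, and_assoc])
  have d3 : HR T (fun ω => (A ω, C1 ω))
      = Real.logb 2 n + (∑ i, HR P (fun ω => (auxV i ω, ω.2.1 i))) / n := by
    rw [← HR_tsP hn hP (fun i ω => (auxV i ω, ω.2.1 i))]
    exact HR_congr hPt.1 (by intro ω ω'; simp only [A, C1, inj, Prod.mk.injEq, and_assoc])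
  have d4 : HR T (fun ω => (A ω, B ω))
      = Real.logb 2 n + (∑ i, HR P (fun ω => (auxV i ω, f ω.1 i))) / n := by
    rw [← HR_tsP hn hP (fun i ω => (auxV i ω, f ω.1 i))]
    exact HR_congr hPt.1 (by intro ω ω'; simp only [A, B, inj, Prod.mk.injEq, and_assoc])
  have d5 : HR T (fun ω => (A ω, B ω, C1 ω))
      = Real.logb 2 n + (∑ i, HR P (fun ω => (auxV i ω, f ω.1 i, ω.2.1 i))) / n := by
    rw [← HR_tsP hn hP (fun i ω => (auxV i ω, f ω.1 i, ω.2.1 i))]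
    exact HR_congr hPt.1 (by intro ω ω'; simp only [A, B, C1, inj, Prod.mk.injEq, and_assoc])
  have d6 : (∑ i, HR P (fun ω => ω.2.2 i)) / n ≤ HR T C2 := by
    have s := HR_submod hPt C2 (fun t => t.1) (fun _ => ())
    have s0 : HR T (fun _ => ()) = 0 := HR_const hPt (by simp)
    have s1 : HR T (fun t => (C2 t, ())) = HR T C2 := HR_congr hPt.1 (by simp)
    have s2 : HR T (fun t => (t.1, ())) = Real.logb 2 n := by
      have := HR_tsP hn hP (fun (_ : Fin n) _ => ())
      simp only [HR_const hP (A := fun _ => ()) (by simp)] at this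
      simpa using this
    have s3 : HR T (fun t => (C2 t, t.1, ()))
        = Real.logb 2 n + (∑ i, HR P (fun ω => ω.2.2 i)) / n := by
      rw [← HR_tsP hn hP (fun i ω => ω.2.2 i)]
      refine HR_congr hPt.1 ?_
      rintro ⟨i, ω⟩ ⟨i', ω'⟩
      simp only [C2, Prod.mk.injEq]; tauto
    linarith
  have hn0 : (0 : ℝ) < n := by exact_mod_cast hn
  simp only [Finset.sum_sub_distrib] at hMY1 hYM hsw
  rw [d1, d2] at I2
  rw [d1, d3, d4, d5] at I1
  have J2 : (∑ i, HR P (fun ω => ω.2.2 i)) + (∑ i, HR P (fun ω => auxV i ω))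
      - (∑ i, HR P (fun ω => (auxV i ω, ω.2.2 i)))
      ≤ n * IVY (margW2 W) (pr T (fun ω => (A ω, B ω))) := by
    rw [I2]
    have := mul_le_mul_of_nonneg_left d6 hn0.le
    rw [mul_div_cancel₀ _ hn0.ne'] at this
    have h2 : (n : ℝ) * (Real.logb 2 n + (∑ i, HR P (fun ω => auxV i ω)) / n + HR T C2 -
        (Real.logb 2 n + (∑ i, HR P (fun ω => (auxV i ω, ω.2.2 i))) / n))
        = n * HR T C2 + (∑ i, HR P (fun ω => auxV i ω))
          - (∑ i, HR P (fun ω => (auxV i ω, ω.2.2 i))) := by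
      field_simp; ring
    rw [h2]; linarith
  have J1 : n * IXYgV (margW1 W) (pr T (fun ω => (A ω, B ω)))
      = (∑ i, HR P (fun ω => (auxV i ω, f ω.1 i))) + (∑ i, HR P (fun ω => (auxV i ω, ω.2.1 i)))
        - (∑ i, HR P (fun ω => (auxV i ω, f ω.1 i, ω.2.1 i)))
        - (∑ i, HR P (fun ω => auxV i ω)) := by
    rw [I1]; field_simp; ring
  constructor
  · linarith
  · rw [mul_add, J1]; linarith

end Conv2

section RC

theorem prod1 {ι S : Type} [Fintype ι] [Fintype S] (w : ι → S → ℝ) (hw : ∀ i, ∑ s, w i s = 1)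
    (b : ι) (F : S → ℝ) :
    ∑ c : ι → S, (∏ i, w i (c i)) * F (c b) = ∑ s, w b s * F s := by
  have h1 : ∀ c : ι → S, (∏ i, w i (c i)) * F (c b)
      = ∏ i, (w i (c i) * if i = b then F (c i) else 1) := by
    intro c
    rw [Finset.prod_mul_distrib]
    simp
  have h2 : ∏ i, ∑ s, (w i s * if i = b then F s else 1)
      = ∑ c : ι → S, ∏ i, (w i (c i) * if i = b then F (c i) else 1) := by
    rw [Finset.prod_univ_sum]; simp
  have h3 : ∀ i, ∑ s, (w i s * if i = b then F s else 1)
      = if i = b then ∑ s, w b s * F s else 1 := by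
    intro i
    by_cases h : i = b
    · subst h; simp
    · simp [h, hw]
  simp only [h1]
  rw [← h2]
  simp only [h3]
  simp

theorem prod2 {ι S : Type} [Fintype ι] [Fintype S] (w : ι → S → ℝ) (hw : ∀ i, ∑ s, w i s = 1)
    {b b' : ι} (hb : b ≠ b') (F G : S → ℝ) :
    ∑ c : ι → S, (∏ i, w i (c i)) * (F (c b) * G (c b'))
      = (∑ s, w b s * F s) * (∑ s, w b' s * G s) := by
  have h1 : ∀ c : ι → S, (∏ i, w i (c i)) * (F (c b) * G (c b'))
      = ∏ i, (w i (c i) * ((if i = b then F (c i) else 1) * (if i = b' then G (c i) else 1))) := by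
    intro c
    rw [Finset.prod_mul_distrib, Finset.prod_mul_distrib]
    simp
  have h2 : ∏ i, ∑ s, (w i s * ((if i = b then F s else 1) * (if i = b' then G s else 1)))
      = ∑ c : ι → S, ∏ i, (w i (c i) *
        ((if i = b then F (c i) else 1) * (if i = b' then G (c i) else 1))) := by
    rw [Finset.prod_univ_sum]; simp
  have h3 : ∀ i, ∑ s, (w i s * ((if i = b then F s else 1) * (if i = b' then G s else 1)))
      = (if i = b then ∑ s, w b s * F s else 1) * (if i = b' then ∑ s, w b' s * G s else 1) := by
    intro i
    by_cases h : i = b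
    · subst h; simp [hb]
    · by_cases h' : i = b'
      · subst h'; simp [h]
      · simp [h, h', hw]
  simp only [h1]
  rw [← h2]
  simp only [h3]
  rw [Finset.prod_mul_distrib]
  simp

variable {A B V X Y1 Y2 : Type} [Fintype A] [Fintype B] [Fintype V] [Fintype X] [Fintype Y1]
  [Fintype Y2]

/-- Law of a single cloud. -/
def cloud (pV : V → ℝ) (K : V → X → ℝ) (s : V × (A → X)) : ℝ := pV s.1 * ∏ a, K s.1 (s.2 a)

/-- Law of the superposition codebook. -/
def cbk (B : Type) [Fintype B] (pV : V → ℝ) (K : V → X → ℝ) (c : B → V × (A → X)) : ℝ :=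
  ∏ b, cloud pV K (c b)

theorem kprod {K : V → X → ℝ} (hK : IsChannel K) (v : V) : ∑ ξ : A → X, ∏ a, K v (ξ a) = 1 := by
  have h2 : ∏ _a : A, ∑ x, K v x = ∑ ξ : A → X, ∏ a, K v (ξ a) := by
    rw [Finset.prod_univ_sum]; simp
  rw [← h2]
  exact Finset.prod_eq_one fun _ _ => (hK v).2

theorem cloud_sum {pV : V → ℝ} (hV : IsPMF pV) {K : V → X → ℝ} (hK : IsChannel K) :
    ∑ s : V × (A → X), cloud pV K s = 1 := by
  unfold cloud
  rw [Fintype.sum_prod_type]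
  simp only [← Finset.mul_sum, kprod hK, mul_one, hV.2]

theorem cbk_sum {pV : V → ℝ} (hV : IsPMF pV) {K : V → X → ℝ} (hK : IsChannel K) :
    ∑ c : B → V × (A → X), cbk B pV K c = 1 := by
  have h2 : ∏ _b : B, ∑ s : V × (A → X), cloud pV K s = ∑ c : B → V × (A → X), cbk B pV K c := by
    unfold cbk
    rw [Finset.prod_univ_sum]; simp
  rw [← h2]
  exact Finset.prod_eq_one fun _ _ => cloud_sum hV hK

theorem cbk_nonneg {pV : V → ℝ} (hV : IsPMF pV) {K : V → X → ℝ} (hK : IsChannel K)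
    (c : B → V × (A → X)) : 0 ≤ cbk B pV K c :=
  Finset.prod_nonneg fun _ _ => mul_nonneg (hV.1 _) (Finset.prod_nonneg fun _ _ => (hK _).1 _)

theorem cloud_single {pV : V → ℝ} {K : V → X → ℝ} (hK : IsChannel K) (a : A) (F : V → X → ℝ) :
    ∑ s : V × (A → X), cloud pV K s * F s.1 (s.2 a) = ∑ v, pV v * ∑ x, K v x * F v x := by
  unfold cloud
  rw [Fintype.sum_prod_type]
  refine Finset.sum_congr rfl fun v _ => ?_
  rw [← prod1 (fun _ : A => K v) (fun _ => (hK v).2) a (F v), Finset.mul_sum]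
  exact Finset.sum_congr rfl fun ξ _ => by ring

theorem cloud_fst {pV : V → ℝ} {K : V → X → ℝ} (hK : IsChannel K) (F : V → ℝ) :
    ∑ s : V × (A → X), cloud pV K s * F s.1 = ∑ v, pV v * F v := by
  unfold cloud
  rw [Fintype.sum_prod_type]
  refine Finset.sum_congr rfl fun v _ => ?_
  simp only
  rw [← Finset.sum_mul, ← Finset.mul_sum, kprod hK, mul_one]

theorem E_single {pV : V → ℝ} (hV : IsPMF pV) {K : V → X → ℝ} (hK : IsChannel K) (a : A) (b : B)
    (F : V → X → ℝ) :
    ∑ c : B → V × (A → X), cbk B pV K c * F (c b).1 ((c b).2 a)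
      = ∑ v, pV v * ∑ x, K v x * F v x := by
  unfold cbk
  rw [prod1 (fun _ : B => cloud pV K) (fun _ => cloud_sum hV hK) b (fun s => F s.1 (s.2 a)),
    cloud_single hK]

theorem E_pair {Y : Type} [Fintype Y] {pV : V → ℝ} (hV : IsPMF pV) {K : V → X → ℝ}
    (hK : IsChannel K) (a : A) {b b' : B} (hb : b ≠ b') (F : X → Y → ℝ) (G : V → Y → ℝ) :
    ∑ c : B → V × (A → X), cbk B pV K c * ∑ y, F ((c b).2 a) y * G (c b').1 y
      = ∑ y, (∑ v, pV v * ∑ x, K v x * F x y) * ∑ v, pV v * G v y := by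
  rw [Finset.sum_congr rfl fun c _ => Finset.mul_sum _ _ _]
  rw [Finset.sum_comm]
  refine Finset.sum_congr rfl fun y _ => ?_
  unfold cbk
  rw [prod2 (fun _ : B => cloud pV K) (fun _ => cloud_sum hV hK) hb (fun s => F (s.2 a) y)
    (fun s => G s.1 y), cloud_single hK a (fun _ x => F x y), cloud_fst hK (fun v => G v y)]

theorem E_in {Y : Type} [Fintype Y] {pV : V → ℝ} (hV : IsPMF pV) {K : V → X → ℝ}
    (hK : IsChannel K) {a a' : A} (ha : a ≠ a') (b : B) (F : X → Y → ℝ) (G : V → X → Y → ℝ) :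
    ∑ c : B → V × (A → X), cbk B pV K c * ∑ y, F ((c b).2 a) y * G (c b).1 ((c b).2 a') y
      = ∑ v, pV v * ∑ y, (∑ x, K v x * F x y) * ∑ x, K v x * G v x y := by
  unfold cbk
  rw [prod1 (fun _ : B => cloud pV K) (fun _ => cloud_sum hV hK) b
    (fun s => ∑ y, F (s.2 a) y * G s.1 (s.2 a') y)]
  unfold cloud
  rw [Fintype.sum_prod_type]
  refine Finset.sum_congr rfl fun v _ => ?_
  have : ∀ y, (∑ x, K v x * F x y) * ∑ x, K v x * G v x y
      = ∑ ξ : A → X, (∏ i, K v (ξ i)) * (F (ξ a) y * G v (ξ a') y) := fun y =>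
    (prod2 (fun _ : A => K v) (fun _ => (hK v).2) ha (fun x => F x y) (fun x => G v x y)).symm
  simp only [this]
  rw [Finset.sum_comm, Finset.mul_sum]
  refine Finset.sum_congr rfl fun ξ _ => ?_
  rw [← Finset.mul_sum]; ring

theorem exists_le_avg {C : Type} [Fintype C] {w : C → ℝ} (hw : ∀ c, 0 ≤ w c) (hs : ∑ c, w c = 1)
    (E : C → ℝ) {D : ℝ} (h : ∑ c, w c * E c ≤ D) : ∃ c, E c ≤ D := by
  by_contra! hc
  obtain ⟨c0, hc0⟩ : ∃ c, 0 < w c := by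
    by_contra! hh
    have : ∑ c, w c ≤ 0 := Finset.sum_nonpos fun c _ => hh c
    linarith
  have : ∑ c, w c * D < ∑ c, w c * E c :=
    Finset.sum_lt_sum (fun c _ => mul_le_mul_of_nonneg_left (hc c).le (hw c))
      ⟨c0, Finset.mem_univ _, mul_lt_mul_of_pos_left (hc c0) hc0⟩
  rw [← Finset.sum_mul, hs, one_mul] at this
  linarith

theorem sum_W1 (W : X → Y1 × Y2 → ℝ) (x : X) (φ : Y1 → ℝ) :
    ∑ y, W x y * φ y.1 = ∑ y1, margW1 W x y1 * φ y1 := by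
  unfold margW1
  rw [Fintype.sum_prod_type]
  exact Finset.sum_congr rfl fun y _ => by rw [Finset.sum_mul]

theorem sum_W2 (W : X → Y1 × Y2 → ℝ) (x : X) (φ : Y2 → ℝ) :
    ∑ y, W x y * φ y.2 = ∑ y2, margW2 W x y2 * φ y2 := by
  unfold margW2
  rw [Fintype.sum_prod_type_right]
  exact Finset.sum_congr rfl fun y _ => by rw [Finset.sum_mul]

/-- Indicator of a proposition. -/
def ind (p : Prop) : ℝ := if p then 1 else 0

theorem ind_nonneg (p : Prop) : 0 ≤ ind p := by unfold ind; split_ifs <;> norm_num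

theorem oneshot [Nonempty A] [Nonempty B] {pV : V → ℝ} (hV : IsPMF pV) {K : V → X → ℝ}
    (hK : IsChannel K) {W : X → Y1 × Y2 → ℝ} (hW : IsChannel W)
    (T2 : V → Y2 → Prop) (T1 : V → Y1 → Prop) (S : V → X → Y1 → Prop) {D1 D2 D3 D4 D5 D6 : ℝ}
    (h1 : ∑ v, pV v * ∑ x, K v x * ∑ y, margW2 W x y * ind (¬ T2 v y) ≤ D1)
    (h2 : ∑ v, pV v * ∑ x, K v x * ∑ y, margW1 W x y * ind (¬ T1 v y) ≤ D2)
    (h3 : ∑ v, pV v * ∑ x, K v x * ∑ y, margW1 W x y * ind (¬ S v x y) ≤ D3)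
    (h4 : ∑ y, (∑ v, pV v * ∑ x, K v x * margW2 W x y) * ∑ v, pV v * ind (T2 v y) ≤ D4)
    (h5 : ∑ y, (∑ v, pV v * ∑ x, K v x * margW1 W x y) * ∑ v, pV v * ind (T1 v y) ≤ D5)
    (h6 : ∑ v, pV v * ∑ y, (∑ x, K v x * margW1 W x y) * ∑ x, K v x * ind (S v x y) ≤ D6) :
    ∃ (f : A × B → X) (g1 : Y1 → A × B) (g2 : Y2 → B),
      (1 : ℝ) / (Fintype.card A * Fintype.card B) *
        ∑ m : A × B, ∑ y, W (f m) y * ind (¬ (g1 y.1 = m ∧ g2 y.2 = m.2))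
      ≤ D1 + D2 + D3 + (Fintype.card B - 1) * (D4 + D5) + (Fintype.card A - 1) * D6 := by
  let g2 : (B → V × (A → X)) → Y2 → B := fun c y =>
    if h : ∃ b, T2 (c b).1 y then h.choose else Classical.arbitrary B
  let g1 : (B → V × (A → X)) → Y1 → A × B := fun c y =>
    if h : ∃ m : A × B, T1 (c m.2).1 y ∧ S (c m.2).1 ((c m.2).2 m.1) y then h.choose
    else Classical.arbitrary (A × B)
  have pt : ∀ (c : B → V × (A → X)) (m : A × B) (y : Y1 × Y2),
      ind (¬ (g1 c y.1 = m ∧ g2 c y.2 = m.2)) ≤ ind (¬ T2 (c m.2).1 y.2) + ind (¬ T1 (c m.2).1 y.1)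
        + ind (¬ S (c m.2).1 ((c m.2).2 m.1) y.1) + ∑ b' ∈ univ.erase m.2, ind (T2 (c b').1 y.2)
        + ∑ b' ∈ univ.erase m.2, ind (T1 (c b').1 y.1)
        + ∑ a' ∈ univ.erase m.1, ind (S (c m.2).1 ((c m.2).2 a') y.1) := by
    intro c m y
    have n1 := ind_nonneg (¬ T2 (c m.2).1 y.2)
    have n2 := ind_nonneg (¬ T1 (c m.2).1 y.1)
    have n3 := ind_nonneg (¬ S (c m.2).1 ((c m.2).2 m.1) y.1)
    have n4 : 0 ≤ ∑ b' ∈ univ.erase m.2, ind (T2 (c b').1 y.2) :=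
      Finset.sum_nonneg fun _ _ => ind_nonneg _
    have n5 : 0 ≤ ∑ b' ∈ univ.erase m.2, ind (T1 (c b').1 y.1) :=
      Finset.sum_nonneg fun _ _ => ind_nonneg _
    have n6 : 0 ≤ ∑ a' ∈ univ.erase m.1, ind (S (c m.2).1 ((c m.2).2 a') y.1) :=
      Finset.sum_nonneg fun _ _ => ind_nonneg _
    have le1 : ind (¬ (g1 c y.1 = m ∧ g2 c y.2 = m.2)) ≤ 1 := by
      unfold ind; split_ifs <;> norm_num
    by_cases q1 : T2 (c m.2).1 y.2
    swap
    · have : ind (¬ T2 (c m.2).1 y.2) = 1 := by simp [ind, q1]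
      linarith
    by_cases q2 : T1 (c m.2).1 y.1
    swap
    · have : ind (¬ T1 (c m.2).1 y.1) = 1 := by simp [ind, q2]
      linarith
    by_cases q3 : S (c m.2).1 ((c m.2).2 m.1) y.1
    swap
    · have : ind (¬ S (c m.2).1 ((c m.2).2 m.1) y.1) = 1 := by simp [ind, q3]
      linarith
    by_cases q4 : ∃ b', b' ≠ m.2 ∧ T2 (c b').1 y.2
    · obtain ⟨b', hb', ht⟩ := q4
      have := Finset.single_le_sum (f := fun b' => ind (T2 (c b').1 y.2))
        (fun _ _ => ind_nonneg _) (Finset.mem_erase.2 ⟨hb', Finset.mem_univ b'⟩)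
      have e : ind (T2 (c b').1 y.2) = 1 := by simp [ind, ht]
      simp only [e] at this
      linarith
    by_cases q5 : ∃ b', b' ≠ m.2 ∧ T1 (c b').1 y.1
    · obtain ⟨b', hb', ht⟩ := q5
      have := Finset.single_le_sum (f := fun b' => ind (T1 (c b').1 y.1))
        (fun _ _ => ind_nonneg _) (Finset.mem_erase.2 ⟨hb', Finset.mem_univ b'⟩)
      have e : ind (T1 (c b').1 y.1) = 1 := by simp [ind, ht]
      simp only [e] at this
      linarith
    by_cases q6 : ∃ a', a' ≠ m.1 ∧ S (c m.2).1 ((c m.2).2 a') y.1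
    · obtain ⟨b', hb', ht⟩ := q6
      have := Finset.single_le_sum (f := fun b' => ind (S (c m.2).1 ((c m.2).2 b') y.1))
        (fun _ _ => ind_nonneg _) (Finset.mem_erase.2 ⟨hb', Finset.mem_univ b'⟩)
      have e : ind (S (c m.2).1 ((c m.2).2 b') y.1) = 1 := by simp [ind, ht]
      simp only [e] at this
      linarith
    push Not at q4 q5 q6
    have r2 : g2 c y.2 = m.2 := by
      have hex : ∃ b, T2 (c b).1 y.2 := ⟨_, q1⟩
      simp only [g2, dif_pos hex]
      by_contra hne
      exact q4 _ hne hex.choose_spec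
    have r1 : g1 c y.1 = m := by
      have hex : ∃ m : A × B, T1 (c m.2).1 y.1 ∧ S (c m.2).1 ((c m.2).2 m.1) y.1 := ⟨_, q2, q3⟩
      simp only [g1, dif_pos hex]
      have hs := hex.choose_spec
      have hb : hex.choose.2 = m.2 := by
        by_contra hne
        exact q5 _ hne hs.1
      have ha : hex.choose.1 = m.1 := by
        by_contra hne
        have := hs.2
        rw [hb] at this
        exact q6 _ hne this
      exact Prod.ext ha hb
    have : ind (¬ (g1 c y.1 = m ∧ g2 c y.2 = m.2)) = 0 := by simp [ind, r1, r2]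
    linarith
  have hA : (0 : ℝ) < Fintype.card A := by exact_mod_cast Fintype.card_pos
  have hB : (0 : ℝ) < Fintype.card B := by exact_mod_cast Fintype.card_pos
  have per : ∀ m : A × B, ∑ c, cbk B pV K c * ∑ y, W ((c m.2).2 m.1) y *
      ind (¬ (g1 c y.1 = m ∧ g2 c y.2 = m.2))
      ≤ D1 + D2 + D3 + (Fintype.card B - 1) * (D4 + D5) + (Fintype.card A - 1) * D6 := by
    rintro ⟨a, b⟩
    have cardB : ((univ.erase b).card : ℝ) = Fintype.card B - 1 := by
      rw [Finset.card_erase_of_mem (Finset.mem_univ _), Finset.card_univ,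
        Nat.cast_sub (Fintype.card_pos), Nat.cast_one]
    have cardA : ((univ.erase a).card : ℝ) = Fintype.card A - 1 := by
      rw [Finset.card_erase_of_mem (Finset.mem_univ _), Finset.card_univ,
        Nat.cast_sub (Fintype.card_pos), Nat.cast_one]
    calc ∑ c, cbk B pV K c * ∑ y, W ((c b).2 a) y *
          ind (¬ (g1 c y.1 = (a, b) ∧ g2 c y.2 = b))
        ≤ ∑ c, cbk B pV K c * (∑ y, margW2 W ((c b).2 a) y * ind (¬ T2 (c b).1 y)
          + ∑ y, margW1 W ((c b).2 a) y * ind (¬ T1 (c b).1 y)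
          + ∑ y, margW1 W ((c b).2 a) y * ind (¬ S (c b).1 ((c b).2 a) y)
          + ∑ b' ∈ univ.erase b, ∑ y, margW2 W ((c b).2 a) y * ind (T2 (c b').1 y)
          + ∑ b' ∈ univ.erase b, ∑ y, margW1 W ((c b).2 a) y * ind (T1 (c b').1 y)
          + ∑ a' ∈ univ.erase a, ∑ y, margW1 W ((c b).2 a) y * ind (S (c b).1 ((c b).2 a') y)) := by
          refine Finset.sum_le_sum fun c _ => ?_
          refine mul_le_mul_of_nonneg_left ?_ (cbk_nonneg hV hK c)
          refine (Finset.sum_le_sum fun y _ => mul_le_mul_of_nonneg_left (pt c (a, b) y)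
            ((hW _).1 y)).trans_eq ?_
          simp only [mul_add, Finset.sum_add_distrib]
          rw [sum_W2 W _ (fun y => ind (¬ T2 (c b).1 y)),
            sum_W1 W _ (fun y => ind (¬ T1 (c b).1 y)),
            sum_W1 W _ (fun y => ind (¬ S (c b).1 ((c b).2 a) y)),
            sum_W2 W _ (fun y => ∑ b' ∈ univ.erase b, ind (T2 (c b').1 y)),
            sum_W1 W _ (fun y => ∑ b' ∈ univ.erase b, ind (T1 (c b').1 y)),
            sum_W1 W _ (fun y => ∑ a' ∈ univ.erase a, ind (S (c b).1 ((c b).2 a') y))]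
          simp only [Finset.mul_sum]
          rw [Finset.sum_comm (s := univ) (t := univ.erase b),
            Finset.sum_comm (s := univ) (t := univ.erase b),
            Finset.sum_comm (s := univ) (t := univ.erase a)]
      _ = ∑ v, pV v * ∑ x, K v x * ∑ y, margW2 W x y * ind (¬ T2 v y)
          + ∑ v, pV v * ∑ x, K v x * ∑ y, margW1 W x y * ind (¬ T1 v y)
          + ∑ v, pV v * ∑ x, K v x * ∑ y, margW1 W x y * ind (¬ S v x y)
          + ∑ b' ∈ univ.erase b, ∑ y, (∑ v, pV v * ∑ x, K v x * margW2 W x y) *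
              ∑ v, pV v * ind (T2 v y)
          + ∑ b' ∈ univ.erase b, ∑ y, (∑ v, pV v * ∑ x, K v x * margW1 W x y) *
              ∑ v, pV v * ind (T1 v y)
          + ∑ a' ∈ univ.erase a, ∑ v, pV v * ∑ y, (∑ x, K v x * margW1 W x y) *
              ∑ x, K v x * ind (S v x y) := by
          simp only [mul_add, Finset.sum_add_distrib]
          rw [E_single hV hK a b (fun v x => ∑ y, margW2 W x y * ind (¬ T2 v y)),
            E_single hV hK a b (fun v x => ∑ y, margW1 W x y * ind (¬ T1 v y)),
            E_single hV hK a b (fun v x => ∑ y, margW1 W x y * ind (¬ S v x y))]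
          congr 1
          · congr 1
            · congr 1
              simp only [Finset.mul_sum (s := univ.erase b)]
              rw [Finset.sum_comm]
              refine Finset.sum_congr rfl fun b' hb' => ?_
              exact E_pair hV hK a (Finset.ne_of_mem_erase hb').symm (margW2 W)
                (fun v y => ind (T2 v y))
            · simp only [Finset.mul_sum (s := univ.erase b)]
              rw [Finset.sum_comm]
              refine Finset.sum_congr rfl fun b' hb' => ?_
              exact E_pair hV hK a (Finset.ne_of_mem_erase hb').symm (margW1 W)
                (fun v y => ind (T1 v y))
          · simp only [Finset.mul_sum (s := univ.erase a)]
            rw [Finset.sum_comm]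
            refine Finset.sum_congr rfl fun a' ha' => ?_
            exact E_in hV hK (Finset.ne_of_mem_erase ha').symm b (margW1 W)
                (fun v x y => ind (S v x y))
      _ ≤ _ := by
          simp only [Finset.sum_const, nsmul_eq_mul, cardA, cardB]
          have gB : (0 : ℝ) ≤ Fintype.card B - 1 := by rw [← cardB]; positivity
          have gA : (0 : ℝ) ≤ Fintype.card A - 1 := by rw [← cardA]; positivity
          have := mul_le_mul_of_nonneg_left h4 gB
          have := mul_le_mul_of_nonneg_left h5 gB
          have := mul_le_mul_of_nonneg_left h6 gA
          linarith
  obtain ⟨c, hc⟩ := exists_le_avg (cbk_nonneg hV hK) (cbk_sum (A := A) (B := B) hV hK)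
    (fun c => (1 : ℝ) / (Fintype.card A * Fintype.card B) *
        ∑ m : A × B, ∑ y, W ((c m.2).2 m.1) y * ind (¬ (g1 c y.1 = m ∧ g2 c y.2 = m.2)))
    (D := D1 + D2 + D3 + (Fintype.card B - 1) * (D4 + D5) + (Fintype.card A - 1) * D6) (by
      have : ∀ c, cbk B pV K c * ((1 : ℝ) / (Fintype.card A * Fintype.card B) *
        ∑ m : A × B, ∑ y, W ((c m.2).2 m.1) y * ind (¬ (g1 c y.1 = m ∧ g2 c y.2 = m.2)))
        = (1 : ℝ) / (Fintype.card A * Fintype.card B) * ∑ m : A × B, cbk B pV K c *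
          ∑ y, W ((c m.2).2 m.1) y * ind (¬ (g1 c y.1 = m ∧ g2 c y.2 = m.2)) := by
        intro c; rw [← Finset.mul_sum]; ring
      simp only [this]
      rw [← Finset.mul_sum, Finset.sum_comm]
      calc _ ≤ (1 : ℝ) / (Fintype.card A * Fintype.card B) * ∑ _m : A × B,
            (D1 + D2 + D3 + (Fintype.card B - 1) * (D4 + D5) + (Fintype.card A - 1) * D6) :=
            mul_le_mul_of_nonneg_left (Finset.sum_le_sum fun m _ => per m) (by positivity)
        _ = _ := by
            rw [Finset.sum_const, nsmul_eq_mul, Finset.card_univ, Fintype.card_prod]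
            push_cast
            field_simp)
  exact ⟨fun m => (c m.2).2 m.1, g1 c, g2 c, hc⟩

end RC

section Cher

theorem ind_mono {p q : Prop} (h : p → q) : ind p ≤ ind q := by
  unfold ind
  by_cases hp : p
  · simp [hp, h hp]
  · simp only [hp, if_false]; split_ifs <;> norm_num

theorem chernoff {Z : Type} [Fintype Z] {p : Z → ℝ} (hp : IsPMF p) (l : Z → ℝ) {c : ℝ}
    (hc : c < ∑ z, p z * l z) : ∃ φ : ℝ, 0 ≤ φ ∧ φ < 1 ∧ ∀ n : ℕ,
      ∑ z : Fin n → Z, (∏ t, p (z t)) * ind (∑ t, l (z t) ≤ n * c) ≤ φ ^ n := by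
  let F : ℝ → ℝ := fun s => ∑ z, p z * Real.exp (s * (c - l z))
  have hF0 : F 0 = 1 := by simp [F, hp.2]
  have hd : HasDerivAt F (∑ z, p z * (c - l z)) 0 := by
    have : ∀ z ∈ (univ : Finset Z), HasDerivAt (fun s => p z * Real.exp (s * (c - l z)))
        (p z * (c - l z)) 0 := by
      intro z _
      have h1 : HasDerivAt (fun s : ℝ => s * (c - l z)) (c - l z) 0 := by
        simpa using (hasDerivAt_id (0:ℝ)).mul_const (c - l z)
      have h2 := (h1.exp).const_mul (p z)
      simpa using h2
    exact HasDerivAt.fun_sum this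
  have hneg : ∑ z, p z * (c - l z) < 0 := by
    simp only [mul_sub, Finset.sum_sub_distrib, ← Finset.sum_mul, hp.2]
    linarith
  obtain ⟨s, hs0, hs1⟩ : ∃ s : ℝ, 0 < s ∧ F s < 1 := by
    have h1 := hd.tendsto_slope_zero_right
    have h2 := h1.eventually (gt_mem_nhds hneg)
    have h3 : ∀ᶠ t in nhdsWithin (0:ℝ) (Set.Ioi 0), 0 < t := self_mem_nhdsWithin
    obtain ⟨s, h4, h5⟩ := (h2.and h3).exists
    refine ⟨s, h5, ?_⟩
    simp only [zero_add, hF0, smul_eq_mul] at h4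
    have : s⁻¹ * (F s - 1) * s < 0 := mul_neg_of_neg_of_pos h4 h5
    have e : s⁻¹ * (F s - 1) * s = F s - 1 := by field_simp
    linarith
  refine ⟨F s, Finset.sum_nonneg fun z _ => mul_nonneg (hp.1 z) (Real.exp_pos _).le, hs1, ?_⟩
  intro n
  have : F s ^ n = ∑ z : Fin n → Z, ∏ t, (p (z t) * Real.exp (s * (c - l (z t)))) := by
    rw [sum_prod_fun (fun _ z => p z * Real.exp (s * (c - l z)))]
    simp [F]
  rw [this]
  refine Finset.sum_le_sum fun z _ => ?_
  rw [Finset.prod_mul_distrib]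
  refine mul_le_mul_of_nonneg_left ?_ (Finset.prod_nonneg fun t _ => hp.1 _)
  rw [← Real.exp_sum]
  unfold ind
  split_ifs with h
  · apply Real.one_le_exp
    rw [← Finset.mul_sum, Finset.sum_sub_distrib]
    simp
    apply mul_nonneg hs0.le
    linarith
  · exact (Real.exp_pos _).le

theorem wrong {V Y : Type} [Fintype V] [Fintype Y] {U : V → ℝ} (hU : IsPMF U) {N : V → Y → ℝ}
    (hN : IsChannel N) (Q : Y → ℝ) {g : ℝ} (hg : 0 < g) :
    ∑ y, Q y * ∑ v, U v * ind (g * Q y < N v y) ≤ 1 / g := by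
  have : (1 : ℝ) / g = ∑ y, ∑ v, U v * (N v y / g) := by
    rw [Finset.sum_comm]
    simp only [← Finset.mul_sum, ← Finset.sum_div, (hN _).2]
    rw [← Finset.sum_mul, hU.2, one_mul]
  rw [this]
  refine Finset.sum_le_sum fun y _ => ?_
  rw [Finset.mul_sum]
  refine Finset.sum_le_sum fun v _ => ?_
  have : Q y * ind (g * Q y < N v y) ≤ N v y / g := by
    unfold ind
    split_ifs with h
    · rw [le_div_iff₀ hg]; linarith
    · rw [mul_zero]; exact div_nonneg ((hN v).1 y) hg.le
  nlinarith [hU.1 v]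

end Cher

section Trip
variable {V X Y : Type} [Fintype V] [Fintype X] [Fintype Y]

/-- output pmf given `v` -/
def pYV (K : V → X → ℝ) (Wm : X → Y → ℝ) (v : V) (y : Y) : ℝ := ∑ x, K v x * Wm x y
/-- output pmf -/
def pY (pV : V → ℝ) (K : V → X → ℝ) (Wm : X → Y → ℝ) (y : Y) : ℝ := ∑ v, pV v * pYV K Wm v y
/-- joint pmf -/
def jP (pV : V → ℝ) (K : V → X → ℝ) (Wm : X → Y → ℝ) (w : V × X × Y) : ℝ :=
  pV w.1 * K w.1 w.2.1 * Wm w.2.1 w.2.2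

theorem pYV_channel {K : V → X → ℝ} (hK : IsChannel K) {Wm : X → Y → ℝ} (hW : IsChannel Wm) :
    IsChannel (pYV K Wm) := by
  intro v
  refine ⟨fun y => Finset.sum_nonneg fun x _ => mul_nonneg ((hK v).1 x) ((hW x).1 y), ?_⟩
  unfold pYV
  rw [Finset.sum_comm]
  simp only [← Finset.mul_sum, (hW _).2, mul_one, (hK v).2]

theorem jP_pmf {pV : V → ℝ} (hV : IsPMF pV) {K : V → X → ℝ} (hK : IsChannel K) {Wm : X → Y → ℝ}
    (hW : IsChannel Wm) : IsPMF (jP pV K Wm) := by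
  refine ⟨fun w => mul_nonneg (mul_nonneg (hV.1 _) ((hK _).1 _)) ((hW _).1 _), ?_⟩
  unfold jP
  simp only [Fintype.sum_prod_type, ← Finset.mul_sum, (hW _).2, mul_one, (hK _).2, hV.2]

theorem jP_pr3 (pV : V → ℝ) (K : V → X → ℝ) (Wm : X → Y → ℝ) (w) :
    pr (jP pV K Wm) (fun w => (w.1, w.2.1, w.2.2)) w = jP pV K Wm w := by
  unfold pr
  rw [Finset.sum_eq_single w]
  · simp
  · intro b _ hb; simp; intro h; exact absurd h hb
  · simp

theorem jP_prVX (pV : V → ℝ) (K : V → X → ℝ) {Wm : X → Y → ℝ} (hW : IsChannel Wm) :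
    pr (jP pV K Wm) (fun w => (w.1, w.2.1)) = fun a => pV a.1 * K a.1 a.2 := by
  funext ⟨v, x⟩
  unfold pr jP
  simp only [Fintype.sum_prod_type, Prod.mk.injEq]
  rw [Finset.sum_eq_single v, Finset.sum_eq_single x]
  · simp [← Finset.mul_sum, (hW x).2]
  · intro b _ hb; simp [hb]
  · simp
  · intro b _ hb; simp [hb]
  · simp

theorem jP_prV {pV : V → ℝ} {K : V → X → ℝ} (hK : IsChannel K) {Wm : X → Y → ℝ}
    (hW : IsChannel Wm) :
    pr (jP pV K Wm) (fun w => w.1) = pV := by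
  funext v
  unfold pr jP
  simp only [Fintype.sum_prod_type]
  rw [Finset.sum_eq_single v]
  · simp [← Finset.mul_sum, (hW _).2, (hK v).2]
  · intro b _ hb; simp [hb]
  · simp

theorem jP_prVY {pV : V → ℝ} {K : V → X → ℝ} {Wm : X → Y → ℝ} :
    pr (jP pV K Wm) (fun w => (w.1, w.2.2)) = fun a => pV a.1 * pYV K Wm a.1 a.2 := by
  funext ⟨v, y⟩
  unfold pr jP pYV
  simp only [Fintype.sum_prod_type, Prod.mk.injEq]
  rw [Finset.sum_eq_single v]
  · rw [Finset.mul_sum]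
    refine Finset.sum_congr rfl fun x _ => ?_
    rw [Finset.sum_eq_single y]
    · simp [mul_assoc]
    · intro b _ hb; simp [hb]
    · simp
  · intro b _ hb; simp [hb]
  · simp

theorem jP_prY {pV : V → ℝ} {K : V → X → ℝ} {Wm : X → Y → ℝ} :
    pr (jP pV K Wm) (fun w => w.2.2) = pY pV K Wm := by
  funext y
  unfold pr jP pY pYV
  simp only [Fintype.sum_prod_type, Finset.mul_sum]
  refine Finset.sum_congr rfl fun v _ => Finset.sum_congr rfl fun x _ => ?_
  rw [Finset.sum_eq_single y]
  · simp [mul_assoc]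
  · intro b _ hb; simp [hb]
  · simp

theorem jP_pos {pV : V → ℝ} (hV : IsPMF pV) {K : V → X → ℝ} (hK : IsChannel K) {Wm : X → Y → ℝ}
    (hW : IsChannel Wm) {v x y} (h : 0 < jP pV K Wm (v, x, y)) :
    0 < pV v ∧ 0 < K v x ∧ 0 < Wm x y ∧ 0 < pYV K Wm v y ∧ 0 < pY pV K Wm y := by
  have hne : pV v * K v x * Wm x y ≠ 0 := h.ne'
  have h1 : 0 < pV v := lt_of_le_of_ne (hV.1 v) (by rintro h0; simp [← h0] at hne)
  have h2 : 0 < K v x := lt_of_le_of_ne ((hK v).1 x) (by rintro h0; simp [← h0] at hne)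
  have h3 : 0 < Wm x y := lt_of_le_of_ne ((hW x).1 y) (by rintro h0; simp [← h0] at hne)
  have h4 : 0 < pYV K Wm v y := lt_of_lt_of_le (mul_pos h2 h3)
    (Finset.single_le_sum (f := fun x => K v x * Wm x y)
      (fun x _ => mul_nonneg ((hK v).1 x) ((hW x).1 y)) (mem_univ x))
  have h5 : 0 < pY pV K Wm y := lt_of_lt_of_le (mul_pos h1 h4)
    (Finset.single_le_sum (f := fun v => pV v * pYV K Wm v y)
      (fun v _ => mul_nonneg (hV.1 v) ((pYV_channel hK hW v).1 y)) (mem_univ v))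
  exact ⟨h1, h2, h3, h4, h5⟩

theorem IVY_log {pV : V → ℝ} (hV : IsPMF pV) {K : V → X → ℝ} (hK : IsChannel K) {Wm : X → Y → ℝ}
    (hW : IsChannel Wm) : IVY Wm (fun a : V × X => pV a.1 * K a.1 a.2)
      = ∑ w, jP pV K Wm w * Real.logb 2 (pYV K Wm w.1 w.2.2 / pY pV K Wm w.2.2) := by
  have hP := jP_pmf hV hK hW
  have := IVY_eq (P := jP pV K Wm) (Wm := Wm) (A := fun w => w.1) (B := fun w => w.2.1)
    (C := fun w => w.2.2) (by
      intro v x c; rw [jP_pr3, jP_prVX pV K hW]; rfl)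
  rw [jP_prVX pV K hW] at this
  rw [this]
  unfold HR
  rw [jP_prV hK hW, jP_prVY, jP_prY, sub_neg_eq_add, ← neg_add, neg_add_eq_sub,
    ← Finset.sum_add_distrib, ← Finset.sum_sub_distrib]
  refine Finset.sum_congr rfl fun w _ => ?_
  rcases (hP.1 w).eq_or_lt with h0 | h0
  · simp [← h0]
  · obtain ⟨h1, h2, h3, h4, h5⟩ := jP_pos hV hK hW h0
    simp only
    rw [Real.logb_mul h1.ne' h4.ne', Real.logb_div h4.ne' h5.ne']
    ring

theorem IXYgV_log {pV : V → ℝ} (hV : IsPMF pV) {K : V → X → ℝ} (hK : IsChannel K) {Wm : X → Y → ℝ}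
    (hW : IsChannel Wm) : IXYgV Wm (fun a : V × X => pV a.1 * K a.1 a.2)
      = ∑ w, jP pV K Wm w * Real.logb 2 (Wm w.2.1 w.2.2 / pYV K Wm w.1 w.2.2) := by
  have hP := jP_pmf hV hK hW
  have hh : ∀ v x c, pr (jP pV K Wm) (fun ω => (ω.1, ω.2.1, ω.2.2)) (v, x, c)
      = pr (jP pV K Wm) (fun ω => (ω.1, ω.2.1)) (v, x) * Wm x c := by
    intro v x c; rw [jP_pr3, jP_prVX pV K hW]; rfl
  have := IXYgV_eq hP (Wm := Wm) hh
  rw [jP_prVX pV K hW] at this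
  rw [this]
  have h2 := HR_W hP (Wm := Wm) hh
  have : ∀ a b c d e : ℝ, c - a = -e → a + b - c - d = e + b - d := by intros; linarith
  rw [this _ _ _ _ _ h2]
  unfold HR
  rw [jP_prV hK hW, jP_prVY, sub_neg_eq_add, ← sub_eq_add_neg,
    ← Finset.sum_sub_distrib, ← Finset.sum_add_distrib]
  refine Finset.sum_congr rfl fun w _ => ?_
  rcases (hP.1 w).eq_or_lt with h0 | h0
  · simp [← h0]
  · obtain ⟨h1, h2, h3, h4, h5⟩ := jP_pos hV hK hW h0
    simp only
    rw [Real.logb_mul h1.ne' h4.ne', Real.logb_div h3.ne' h4.ne']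
    ring

theorem sum_triple {n : ℕ} (F : (Fin n → V) → (Fin n → X) → (Fin n → Y) → ℝ) :
    ∑ v, ∑ x, ∑ y, F v x y = ∑ z : Fin n → V × X × Y, F (fun t => (z t).1) (fun t => (z t).2.1)
      (fun t => (z t).2.2) := by
  rw [← sum_pairfun (fun w : (Fin n → V) × (Fin n → X × Y) =>
    F w.1 (fun t => (w.2 t).1) (fun t => (w.2 t).2)), Fintype.sum_prod_type]
  refine Finset.sum_congr rfl fun v _ => ?_
  rw [← sum_pairfun (fun w : (Fin n → X) × (Fin n → Y) => F v w.1 w.2), Fintype.sum_prod_type]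

theorem tail {pV : V → ℝ} (hV : IsPMF pV) {K : V → X → ℝ} (hK : IsChannel K) {Wm : X → Y → ℝ}
    (hW : IsChannel Wm) (N D : V → X → Y → ℝ)
    (hN : ∀ v x y, 0 < jP pV K Wm (v, x, y) → 0 < N v x y ∧ 0 < D v x y) {c : ℝ}
    (hc : c < ∑ w, jP pV K Wm w * Real.logb 2 (N w.1 w.2.1 w.2.2 / D w.1 w.2.1 w.2.2)) :
    ∃ φ : ℝ, 0 ≤ φ ∧ φ < 1 ∧ ∀ n : ℕ,
      ∑ v : Fin n → V, (∏ t, pV (v t)) * ∑ x : Fin n → X, (∏ t, K (v t) (x t)) *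
        ∑ y : Fin n → Y, (∏ t, Wm (x t) (y t)) *
          ind (¬ ((2:ℝ) ^ ((n:ℝ) * c) * ∏ t, D (v t) (x t) (y t) < ∏ t, N (v t) (x t) (y t))) ≤ φ ^ n := by
  have hP := jP_pmf hV hK hW
  obtain ⟨φ, h0, h1, h⟩ := chernoff hP _ hc
  refine ⟨φ, h0, h1, fun n => le_trans ?_ (h n)⟩
  simp only [Finset.mul_sum]
  rw [sum_triple]
  refine Finset.sum_le_sum fun z _ => ?_
  rw [← mul_assoc, ← mul_assoc, ← Finset.prod_mul_distrib, ← Finset.prod_mul_distrib]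
  change (∏ t, jP pV K Wm (z t)) * _ ≤ _
  have hnn : 0 ≤ ∏ t, jP pV K Wm (z t) := Finset.prod_nonneg fun t _ => hP.1 _
  rcases hnn.eq_or_lt with e | hpos
  · simp [← e]
  refine mul_le_mul_of_nonneg_left ?_ hnn
  have hp : ∀ t, 0 < jP pV K Wm (z t) := by
    intro t
    refine lt_of_le_of_ne (hP.1 _) fun e => hpos.ne' ?_
    exact Finset.prod_eq_zero (mem_univ t) e.symm
  refine ind_mono fun h2 => ?_
  · rw [not_lt] at h2
    have hD : 0 < ∏ t, D (z t).1 (z t).2.1 (z t).2.2 :=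
      Finset.prod_pos fun t _ => (hN _ _ _ (hp t)).2
    have hNp : 0 < ∏ t, N (z t).1 (z t).2.1 (z t).2.2 :=
      Finset.prod_pos fun t _ => (hN _ _ _ (hp t)).1
    have e1 : ∑ t, Real.logb 2 (N (z t).1 (z t).2.1 (z t).2.2 / D (z t).1 (z t).2.1 (z t).2.2)
        = Real.logb 2 (∏ t, N (z t).1 (z t).2.1 (z t).2.2 / D (z t).1 (z t).2.1 (z t).2.2) := by
      rw [Real.logb_prod]
      intro t _
      exact (div_pos (hN _ _ _ (hp t)).1 (hN _ _ _ (hp t)).2).ne'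
    rw [e1, Finset.prod_div_distrib, Real.logb_le_iff_le_rpow (by norm_num) (div_pos hNp hD),
      div_le_iff₀ hD]
    exact h2

theorem prod_pmf {Z : Type} [Fintype Z] {p : Z → ℝ} (hp : IsPMF p) (n : ℕ) :
    IsPMF (fun z : Fin n → Z => ∏ t, p (z t)) := by
  refine ⟨fun z => Finset.prod_nonneg fun t _ => hp.1 _, ?_⟩
  rw [sum_prod_fun (fun _ => p)]
  simp [hp.2]

theorem prod_channel {K : X → Y → ℝ} (hK : IsChannel K) (n : ℕ) :
    IsChannel (fun (x : Fin n → X) (y : Fin n → Y) => ∏ t, K (x t) (y t)) := by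
  intro x
  refine ⟨fun z => Finset.prod_nonneg fun t _ => (hK _).1 _, ?_⟩
  rw [sum_prod_fun (fun t y => K (x t) y)]
  simp [(hK _).2]

theorem prod_pYV {K : V → X → ℝ} {Wm : X → Y → ℝ} {n : ℕ} (v : Fin n → V) (y : Fin n → Y) :
    ∑ x : Fin n → X, (∏ t, K (v t) (x t)) * ∏ t, Wm (x t) (y t) = ∏ t, pYV K Wm (v t) (y t) := by
  simp only [← Finset.prod_mul_distrib]
  exact sum_prod_fun (fun t x => K (v t) x * Wm x (y t))

theorem prod_pY {pV : V → ℝ} {K : V → X → ℝ} {Wm : X → Y → ℝ} {n : ℕ} (y : Fin n → Y) :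
    ∑ v : Fin n → V, (∏ t, pV (v t)) * ∏ t, pYV K Wm (v t) (y t) = ∏ t, pY pV K Wm (y t) := by
  simp only [← Finset.prod_mul_distrib]
  exact sum_prod_fun (fun t v => pV v * pYV K Wm v (y t))

end Trip

section Nshot
variable {V X Y1 Y2 : Type} [Fintype V] [Fintype X] [Fintype Y1] [Fintype Y2]

theorem marg1_channel {W : X → Y1 × Y2 → ℝ} (hW : IsChannel W) : IsChannel (margW1 W) := by
  intro x
  refine ⟨fun y => Finset.sum_nonneg fun _ _ => (hW x).1 _, ?_⟩
  unfold margW1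
  rw [← Fintype.sum_prod_type']
  exact (hW x).2

theorem marg2_channel {W : X → Y1 × Y2 → ℝ} (hW : IsChannel W) : IsChannel (margW2 W) := by
  intro x
  refine ⟨fun y => Finset.sum_nonneg fun _ _ => (hW x).1 _, ?_⟩
  unfold margW2
  rw [← Fintype.sum_prod_type_right']
  exact (hW x).2

theorem q_split {q : V × X → ℝ} (hq : IsPMF q) : ∃ (pV : V → ℝ) (K : V → X → ℝ), IsPMF pV ∧
    IsChannel K ∧ q = fun a => pV a.1 * K a.1 a.2 := by
  have hs : ∑ v, ∑ x, q (v, x) = 1 := by rw [← Fintype.sum_prod_type']; exact hq.2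
  refine ⟨fun v => ∑ x, q (v, x), fun v x => if ∑ x, q (v, x) = 0 then ∑ v', q (v', x)
    else q (v, x) / ∑ x, q (v, x), ⟨fun v => Finset.sum_nonneg fun _ _ => hq.1 _, hs⟩, ?_, ?_⟩
  · intro v
    by_cases h : ∑ x, q (v, x) = 0
    · simp only [h, if_true]
      refine ⟨fun x => Finset.sum_nonneg fun _ _ => hq.1 _, ?_⟩
      rw [Finset.sum_comm, hs]
    · simp only [h, if_false]
      refine ⟨fun x => div_nonneg (hq.1 _) (Finset.sum_nonneg fun _ _ => hq.1 _), ?_⟩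
      rw [← Finset.sum_div, div_self h]
  · funext ⟨v, x⟩
    by_cases h : ∑ x, q (v, x) = 0
    · simp only [h, if_true, zero_mul]
      exact (Finset.sum_eq_zero_iff_of_nonneg (fun _ _ => hq.1 _)).1 h x (mem_univ x)
    · simp only [h, if_false]
      field_simp

theorem nshot {q : V × X → ℝ} (hq : IsPMF q) {W : X → Y1 × Y2 → ℝ} (hW : IsChannel W)
    {cS cT : ℝ} (hS : cS < IXYgV (margW1 W) q) (hT2 : cT < IVY (margW2 W) q)
    (hT1 : cT < IVY (margW1 W) q) :
    ∃ φ : ℝ, 0 ≤ φ ∧ φ < 1 ∧ ∀ (n : ℕ) (A B : Type) [Fintype A] [Fintype B] [Nonempty A]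
      [Nonempty B], ∃ (f : A × B → Fin n → X) (g1 : (Fin n → Y1) → A × B)
        (g2 : (Fin n → Y2) → B),
      (1 : ℝ) / (Fintype.card A * Fintype.card B) *
        ∑ m : A × B, ∑ y, nFold W n (f m) y * ind (¬ (g1 y.1 = m ∧ g2 y.2 = m.2))
      ≤ 3 * φ ^ n + 2 * ((Fintype.card B - 1) * (2:ℝ) ^ (-((n:ℝ) * cT)))
        + (Fintype.card A - 1) * (2:ℝ) ^ (-((n:ℝ) * cS)) := by
  obtain ⟨pV, K, hV, hK, rfl⟩ := q_split hq
  have hW1 := marg1_channel hW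
  have hW2 := marg2_channel hW
  rw [IXYgV_log hV hK hW1] at hS
  rw [IVY_log hV hK hW1] at hT1
  rw [IVY_log hV hK hW2] at hT2
  obtain ⟨φ1, a1, b1, c1⟩ := tail hV hK hW2 (fun v _ y => pYV K (margW2 W) v y)
    (fun _ _ y => pY pV K (margW2 W) y)
    (fun v x y h => ⟨(jP_pos hV hK hW2 h).2.2.2.1, (jP_pos hV hK hW2 h).2.2.2.2⟩) hT2
  obtain ⟨φ2, a2, b2, c2⟩ := tail hV hK hW1 (fun v _ y => pYV K (margW1 W) v y)
    (fun _ _ y => pY pV K (margW1 W) y)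
    (fun v x y h => ⟨(jP_pos hV hK hW1 h).2.2.2.1, (jP_pos hV hK hW1 h).2.2.2.2⟩) hT1
  obtain ⟨φ3, a3, b3, c3⟩ := tail hV hK hW1 (fun _ x y => margW1 W x y)
    (fun v _ y => pYV K (margW1 W) v y)
    (fun v x y h => ⟨(jP_pos hV hK hW1 h).2.2.1, (jP_pos hV hK hW1 h).2.2.2.1⟩) hS
  refine ⟨max φ1 (max φ2 φ3), le_max_of_le_left a1, max_lt b1 (max_lt b2 b3), ?_⟩
  intro n A B _ _ _ _
  have hV' := prod_pmf hV n
  have hK' := prod_channel hK n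
  have hW' : IsChannel (nFold W n) := fun x => ⟨nFold_nonneg hW n x, nFold_sum hW n x⟩
  have m1 : margW1 (nFold W n) = fun x y => ∏ t, margW1 W (x t) (y t) := by
    funext x y; exact nFold_marg1 n x y
  have m2 : margW2 (nFold W n) = fun x y => ∏ t, margW2 W (x t) (y t) := by
    funext x y; exact nFold_marg2 n x y
  have hgT : (0:ℝ) < (2:ℝ) ^ ((n:ℝ) * cT) := by positivity
  have hgS : (0:ℝ) < (2:ℝ) ^ ((n:ℝ) * cS) := by positivity
  obtain ⟨f, g1, g2, h⟩ := oneshot (A := A) (B := B) hV' hK' hW'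
    (T2 := fun v y => (2:ℝ) ^ ((n:ℝ) * cT) * ∏ t, pY pV K (margW2 W) (y t)
      < ∏ t, pYV K (margW2 W) (v t) (y t))
    (T1 := fun v y => (2:ℝ) ^ ((n:ℝ) * cT) * ∏ t, pY pV K (margW1 W) (y t)
      < ∏ t, pYV K (margW1 W) (v t) (y t))
    (S := fun v x y => (2:ℝ) ^ ((n:ℝ) * cS) * ∏ t, pYV K (margW1 W) (v t) (y t)
      < ∏ t, margW1 W (x t) (y t))
    (D1 := φ1 ^ n) (D2 := φ2 ^ n) (D3 := φ3 ^ n)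
    (D4 := 1 / (2:ℝ) ^ ((n:ℝ) * cT)) (D5 := 1 / (2:ℝ) ^ ((n:ℝ) * cT))
    (D6 := 1 / (2:ℝ) ^ ((n:ℝ) * cS))
    (by rw [m2]; exact c1 n) (by rw [m1]; exact c2 n) (by rw [m1]; exact c3 n)
    (by
      rw [m2]
      simp only [prod_pYV, prod_pY]
      exact wrong hV' (prod_channel (pYV_channel hK hW2) n) _ hgT)
    (by
      rw [m1]
      simp only [prod_pYV, prod_pY]
      exact wrong hV' (prod_channel (pYV_channel hK hW1) n) _ hgT)
    (by
      rw [m1]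
      simp only [prod_pYV]
      have : (1:ℝ) / (2:ℝ) ^ ((n:ℝ) * cS)
          = ∑ v : Fin n → V, (∏ t, pV (v t)) * (1 / (2:ℝ) ^ ((n:ℝ) * cS)) := by
        rw [← Finset.sum_mul, hV'.2, one_mul]
      rw [this]
      refine Finset.sum_le_sum fun v _ => mul_le_mul_of_nonneg_left ?_ (hV'.1 v)
      exact wrong (hK' v) (prod_channel hW1 n) _ hgS)
  refine ⟨f, g1, g2, h.trans ?_⟩
  have p1 : φ1 ^ n ≤ max φ1 (max φ2 φ3) ^ n := pow_le_pow_left₀ a1 (le_max_left _ _) n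
  have p2 : φ2 ^ n ≤ max φ1 (max φ2 φ3) ^ n := pow_le_pow_left₀ a2 (by simp) n
  have p3 : φ3 ^ n ≤ max φ1 (max φ2 φ3) ^ n := pow_le_pow_left₀ a3 (by simp) n
  rw [Real.rpow_neg (by norm_num), Real.rpow_neg (by norm_num), ← one_div, ← one_div]
  linarith

theorem rate {b I : ℝ} (h : b = 0 ∨ b < I) : ∃ c < I, ∃ r : ℝ, 0 ≤ r ∧ r < 1 ∧
    ∀ (n : ℕ) (k C : ℝ), 0 ≤ C → k - 1 ≤ C * (2:ℝ) ^ ((n:ℝ) * b) → (b = 0 → k = 1) →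
      (k - 1) * (2:ℝ) ^ (-((n:ℝ) * c)) ≤ C * r ^ n := by
  rcases h with rfl | h
  · refine ⟨I - 1, by linarith, 0, le_rfl, by norm_num, ?_⟩
    intro n k C hC _ h
    rw [h rfl]
    simp only [sub_self, zero_mul]
    positivity
  · obtain ⟨c, h1, h2⟩ := exists_between h
    refine ⟨c, h2, (2:ℝ) ^ (b - c), by positivity,
      Real.rpow_lt_one_of_one_lt_of_neg (by norm_num) (by linarith), ?_⟩
    intro n k C hC hk _
    have e : ((2:ℝ) ^ (b - c)) ^ n = (2:ℝ) ^ ((n:ℝ) * b) * (2:ℝ) ^ (-((n:ℝ) * c)) := by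
      rw [← Real.rpow_natCast, ← Real.rpow_mul (by norm_num), ← Real.rpow_add (by norm_num)]
      congr 1; ring
    rw [e, ← mul_assoc]
    exact mul_le_mul_of_nonneg_right hk (by positivity)

theorem err_split {W : X → Y1 × Y2 → ℝ} (hW : IsChannel W) {n ka kc k2 : ℕ}
    (f : Fin ka × (Fin kc × Fin k2) → Fin n → X)
    (g1 : (Fin n → Y1) → Fin ka × (Fin kc × Fin k2)) (g2 : (Fin n → Y2) → Fin kc × Fin k2) :
    ∃ f' g1' g2', errP0 W n (ka * kc) k2 f' g1' g2' ≤
      (1 : ℝ) / (Fintype.card (Fin ka) * Fintype.card (Fin kc × Fin k2)) *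
        ∑ m, ∑ y, nFold W n (f m) y * ind (¬ (g1 y.1 = m ∧ g2 y.2 = m.2)) := by
  let E : Fin (ka * kc) × Fin k2 ≃ Fin ka × (Fin kc × Fin k2) :=
    (finProdFinEquiv.symm.prodCongr (Equiv.refl _)).trans (Equiv.prodAssoc _ _ _)
  refine ⟨fun m => f (E m), fun y => (E.symm (g1 y)).1, fun y => (g2 y).2, ?_⟩
  unfold errP0
  rw [← Equiv.sum_comp E]
  have : (1:ℝ) / (((ka * kc : ℕ) : ℝ) * k2)
      = 1 / (Fintype.card (Fin ka) * Fintype.card (Fin kc × Fin k2)) := by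
    simp [mul_assoc]
  rw [this]
  refine mul_le_mul_of_nonneg_left ?_ (by positivity)
  refine Finset.sum_le_sum fun m _ => Finset.sum_le_sum fun y _ => ?_
  refine mul_le_mul_of_nonneg_left ?_ (nFold_nonneg hW _ _ _)
  by_cases h : g1 y.1 = E m ∧ g2 y.2 = (E m).2
  · have : (E.symm (g1 y.1)).1 = m.1 ∧ (g2 y.2).2 = m.2 := by
      rw [h.1, h.2, Equiv.symm_apply_apply]; exact ⟨rfl, rfl⟩
    simp [this, ind_nonneg]
  · unfold ind
    simp only [h]
    split_ifs <;> simp_all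

theorem ach {q : V × X → ℝ} (hq : IsPMF q) {W : X → Y1 × Y2 → ℝ} (hW : IsChannel W)
    (hln : IVY (margW2 W) q ≤ IVY (margW1 W) q) {R1 R2 a b : ℝ} (hR1 : 0 ≤ R1) (hR2 : 0 ≤ R2)
    (ha0 : 0 ≤ a) (ha : a = 0 ∨ a < IXYgV (margW1 W) q)
    (hb : b = 0 ∨ b < IVY (margW2 W) q) (h2 : R2 ≤ b) (h12 : R1 + R2 ≤ a + b) :
    Ach0 W (R1, R2) := by
  refine ⟨hR1, hR2, fun ε hε => ?_⟩
  obtain ⟨cS, hS, r, hr0, hr1, hr⟩ := rate ha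
  obtain ⟨cT, hT, s, hs0, hs1, hs⟩ := rate hb
  obtain ⟨φ, hφ0, hφ1, H⟩ := nshot hq hW hS hT (hT.trans_le hln)
  have hlim : Filter.Tendsto (fun n : ℕ => 3 * φ ^ n + 2 * (4 * s ^ n) + 1 * r ^ n)
      Filter.atTop (nhds 0) := by
    have := (((tendsto_pow_atTop_nhds_zero_of_lt_one hφ0 hφ1).const_mul 3).add
      (((tendsto_pow_atTop_nhds_zero_of_lt_one hs0 hs1).const_mul 4).const_mul 2)).add
      ((tendsto_pow_atTop_nhds_zero_of_lt_one hr0 hr1).const_mul 1)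
    simpa using this
  obtain ⟨n, hn, hn0⟩ := ((hlim.eventually (gt_mem_nhds hε)).and
    (Filter.eventually_gt_atTop 0)).exists
  have hnR : (0:ℝ) < n := by exact_mod_cast hn0
  obtain ⟨a', c, ha'0, hc0, e1, haa, hcb⟩ : ∃ a' c : ℝ, 0 ≤ a' ∧ 0 ≤ c ∧ R1 = a' + c ∧ a' ≤ a ∧
      c + R2 ≤ b := by
    rcases le_total R1 a with h | h
    · exact ⟨R1, 0, hR1, le_rfl, by ring, h, by linarith⟩
    · exact ⟨a, R1 - a, ha0, by linarith, by ring, le_rfl, by linarith⟩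
  have kle : ∀ u : ℝ, 0 ≤ u → (2:ℝ) ^ ((n:ℝ) * u) ≤ (⌈(2:ℝ) ^ ((n:ℝ) * u)⌉₊ : ℝ) ∧
      (⌈(2:ℝ) ^ ((n:ℝ) * u)⌉₊ : ℝ) - 1 ≤ (2:ℝ) ^ ((n:ℝ) * u) ∧ 1 ≤ (2:ℝ) ^ ((n:ℝ) * u) ∧
      0 < ⌈(2:ℝ) ^ ((n:ℝ) * u)⌉₊ := by
    intro u hu
    have hp : (0:ℝ) < (2:ℝ) ^ ((n:ℝ) * u) := by positivity
    refine ⟨Nat.le_ceil _, ?_, Real.one_le_rpow (by norm_num) (by positivity), Nat.ceil_pos.2 hp⟩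
    have := Nat.ceil_lt_add_one hp.le
    linarith
  obtain ⟨A1, A2, A3, A4⟩ := kle a' ha'0
  obtain ⟨C1, C2, C3, C4⟩ := kle c hc0
  obtain ⟨B1, B2, B3, B4⟩ := kle R2 hR2
  have kz : ⌈(2:ℝ) ^ ((n:ℝ) * 0)⌉₊ = 1 := by simp
  have Az : a = 0 → (⌈(2:ℝ) ^ ((n:ℝ) * a')⌉₊ : ℝ) = 1 := by
    intro h
    have : a' = 0 := by linarith
    rw [this, kz]; simp
  have Bz : b = 0 → ((⌈(2:ℝ) ^ ((n:ℝ) * c)⌉₊ * ⌈(2:ℝ) ^ ((n:ℝ) * R2)⌉₊ : ℕ) : ℝ) = 1 := by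
    intro h
    have h1 : c = 0 := by linarith
    have h2 : R2 = 0 := by linarith
    rw [h1, h2, kz]; simp
  have Aub : (⌈(2:ℝ) ^ ((n:ℝ) * a')⌉₊ : ℝ) - 1 ≤ 1 * (2:ℝ) ^ ((n:ℝ) * a) := by
    rw [one_mul]
    exact A2.trans (Real.rpow_le_rpow_of_exponent_le (by norm_num)
      (mul_le_mul_of_nonneg_left haa hnR.le))
  have Bub : ((⌈(2:ℝ) ^ ((n:ℝ) * c)⌉₊ * ⌈(2:ℝ) ^ ((n:ℝ) * R2)⌉₊ : ℕ) : ℝ) - 1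
      ≤ 4 * (2:ℝ) ^ ((n:ℝ) * b) := by
    have h1 : (2:ℝ) ^ ((n:ℝ) * c) * (2:ℝ) ^ ((n:ℝ) * R2) ≤ (2:ℝ) ^ ((n:ℝ) * b) := by
      rw [← Real.rpow_add (by norm_num)]
      refine Real.rpow_le_rpow_of_exponent_le (by norm_num) ?_
      rw [← mul_add]
      exact mul_le_mul_of_nonneg_left hcb hnR.le
    push_cast
    have h3 : (⌈(2:ℝ) ^ ((n:ℝ) * c)⌉₊ : ℝ) * ⌈(2:ℝ) ^ ((n:ℝ) * R2)⌉₊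
        ≤ (2 * (2:ℝ) ^ ((n:ℝ) * c)) * (2 * (2:ℝ) ^ ((n:ℝ) * R2)) :=
      mul_le_mul (by linarith) (by linarith) (by positivity) (by positivity)
    linarith
  generalize hka : ⌈(2:ℝ) ^ ((n:ℝ) * a')⌉₊ = ka at *
  generalize hkc : ⌈(2:ℝ) ^ ((n:ℝ) * c)⌉₊ = kc at *
  generalize hk2 : ⌈(2:ℝ) ^ ((n:ℝ) * R2)⌉₊ = k2 at *
  have : Nonempty (Fin ka) := ⟨⟨0, A4⟩⟩
  have : Nonempty (Fin kc) := ⟨⟨0, C4⟩⟩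
  have : Nonempty (Fin k2) := ⟨⟨0, B4⟩⟩
  obtain ⟨f, g1, g2, h⟩ := H n (Fin ka) (Fin kc × Fin k2)
  obtain ⟨f', g1', g2', h'⟩ := err_split hW f g1 g2
  refine ⟨n, ka * kc, k2, hn0, Nat.mul_pos A4 C4, B4, f', g1', g2', ?_, ?_, ?_⟩
  · simp only
    rw [le_div_iff₀ hnR, Real.le_logb_iff_rpow_le (by norm_num) (by positivity)]
    push_cast
    rw [e1, show (a' + c) * (n:ℝ) = n * a' + n * c by ring, Real.rpow_add (by norm_num)]
    exact mul_le_mul A1 C1 (by positivity) (by positivity)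
  · simp only
    rw [le_div_iff₀ hnR, Real.le_logb_iff_rpow_le (by norm_num) (by positivity), mul_comm]
    exact B1
  · refine h'.trans (h.trans ?_)
    have t1 := hr n ka 1 (by norm_num) Aub Az
    have t2 := hs n _ 4 (by norm_num) Bub Bz
    rw [Fintype.card_prod]
    simp only [Fintype.card_fin]
    linarith

end Nshot

section Final
variable {X Y1 Y2 : Type} [Fintype X] [Fintype Y1] [Fintype Y2]

theorem ach0_ach1 {W : X → Y1 × Y2 → ℝ} {R : ℝ × ℝ} (h : Ach0 W R) : Ach1 W R := by
  refine ⟨h.1, h.2.1, fun ε hε => ?_⟩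
  obtain ⟨n, k1, k2, hn, h1, h2, f, g1, g2, r1, r2, he⟩ := h.2.2 ε hε
  exact ⟨n, k1, k2, hn, h1, h2, f, fun y => g1 y.1, g2, r1, r2, he⟩

theorem conv_rates {W : X → Y1 × Y2 → ℝ} (hW : IsChannel W) {R : ℝ × ℝ} (h : Ach1 W R) {η : ℝ}
    (hη : 0 < η) (hη1 : η < 1) : ∃ (k : ℕ) (q : Fin k × X → ℝ), IsPMF q ∧
      (1 - η) * R.2 ≤ IVY (margW2 W) q + η ∧
      (1 - η) * (R.1 + R.2) ≤ IXYgV (margW1 W) q + IVY (margW2 W) q + 2 * η := by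
  obtain ⟨δ, hδ0, hδ1, hδ⟩ : ∃ δ : ℝ, 0 < δ ∧ δ < 1 ∧ -Real.logb 2 (1 - δ) = η / 2 := by
    have h1 : (2:ℝ) ^ (-(η / 2)) < 1 :=
      Real.rpow_lt_one_of_one_lt_of_neg (by norm_num) (by linarith)
    have h2 : (0:ℝ) < (2:ℝ) ^ (-(η / 2)) := by positivity
    refine ⟨1 - (2:ℝ) ^ (-(η / 2)), by linarith, by linarith, ?_⟩
    rw [sub_sub_cancel, Real.logb_rpow (by norm_num) (by norm_num)]
    ring
  have hL : 0 < -Real.logb 2 δ := by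
    have := Real.logb_neg (b := 2) (by norm_num) hδ0 hδ1
    linarith
  obtain ⟨ε, hε, hεη, hεL⟩ : ∃ ε : ℝ, 0 < ε ∧ ε ≤ η ∧ ε * (-Real.logb 2 δ) ≤ η / 2 := by
    refine ⟨min η (η / 2 / (-Real.logb 2 δ)), lt_min hη (by positivity), min_le_left _ _, ?_⟩
    calc _ ≤ (η / 2 / (-Real.logb 2 δ)) * (-Real.logb 2 δ) :=
          mul_le_mul_of_nonneg_right (min_le_right _ _) hL.le
      _ = η / 2 := div_mul_cancel₀ _ hL.ne'
  obtain ⟨n, k1, k2, hn, h1, h2, f, g1, g2, r1, r2, he⟩ := h.2.2 ε hε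
  obtain ⟨k, q, hq, c1, c2⟩ := converse hW hn h1 h2 f g1 g2 hδ0 hδ1 he
  refine ⟨k, q, hq, ?_, ?_⟩
  all_goals
    have hnR : (0:ℝ) < n := by exact_mod_cast hn
    have hn1 : (1:ℝ) ≤ n := by exact_mod_cast hn
    rw [le_div_iff₀ hnR] at r1 r2
    have l1 : 0 ≤ Real.logb 2 (k1:ℝ) :=
      Real.logb_nonneg (by norm_num) (by exact_mod_cast h1)
    have l2 : 0 ≤ Real.logb 2 (k2:ℝ) :=
      Real.logb_nonneg (by norm_num) (by exact_mod_cast h2)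
    have m1 := mul_le_mul_of_nonneg_right hεη l1
    have m2 := mul_le_mul_of_nonneg_right hεη l2
    have m3 : η ≤ n * η := le_mul_of_one_le_left hη.le hn1
    have m4 := mul_le_mul_of_nonneg_left r1 (sub_nonneg.2 hη1.le)
    have m5 := mul_le_mul_of_nonneg_left r2 (sub_nonneg.2 hη1.le)
    refine le_of_mul_le_mul_left ?_ hnR
    rw [hδ] at c1 c2
    linarith

theorem ach1_pt {W : X → Y1 × Y2 → ℝ} (hW : IsChannel W) (hln : EssLessNoisy W) {R : ℝ × ℝ}
    (h : Ach1 W R) {η : ℝ} (hη : 0 < η) (hη1 : η < 1) :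
    Ach0 W (max 0 ((1 - η) * R.1 - 4 * η), max 0 ((1 - η) * R.2 - 2 * η)) := by
  obtain ⟨P, hP, hless⟩ := hln
  obtain ⟨k, q, hq, c1, c2⟩ := conv_rates hW h hη hη1
  obtain ⟨k1', k2', p', hp', hm, -, s2, -, s4⟩ := hP 1 k (fun a => q (a.2.1, a.2.2))
    ⟨fun a => hq.1 _, by
      rw [Fintype.sum_prod_type]
      simpa using hq.2⟩
  simp only [Finset.univ_unique, Finset.sum_singleton] at s2 s4
  have hq' : IsPMF (fun a : Fin k2' × X => ∑ v1, p' (v1, a.1, a.2)) := by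
    refine ⟨fun a => Finset.sum_nonneg fun _ _ => hp'.1 _, ?_⟩
    rw [Finset.sum_comm, ← Fintype.sum_prod_type']
    exact hp'.2
  have hle := hless k2' _ hq' (by
    convert hm using 1
    funext x
    exact Finset.sum_comm)
  generalize (fun a : Fin k2' × X => ∑ v1, p' (v1, a.1, a.2)) = q' at *
  change IVY (margW2 W) q ≤ _ at s2
  change IXYgV (margW1 W) q + IVY (margW2 W) q ≤ _ at s4
  have n1 : 0 ≤ (1 - η) * R.1 := mul_nonneg (by linarith) h.1
  have n2 : 0 ≤ (1 - η) * R.2 := mul_nonneg (by linarith) h.2.1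
  have a1 := le_max_left 0 (IXYgV (margW1 W) q' - η)
  have a2 := le_max_right 0 (IXYgV (margW1 W) q' - η)
  have b1 := le_max_left 0 (IVY (margW2 W) q' - η)
  have b2 := le_max_right 0 (IVY (margW2 W) q' - η)
  have key : ∀ I : ℝ, max 0 (I - η) = 0 ∨ max 0 (I - η) < I := by
    intro I
    rcases le_total (I - η) 0 with h | h
    · exact Or.inl (max_eq_left h)
    · right; rw [max_eq_right h]; linarith
  refine ach hq' hW hle (a := max 0 (IXYgV (margW1 W) q' - η))
    (b := max 0 (IVY (margW2 W) q' - η)) (le_max_left _ _) (le_max_left _ _) a1 (key _) (key _)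
    ?_ ?_
  · apply max_le <;> linarith
  · rcases max_cases 0 ((1 - η) * R.1 - 4 * η) with ⟨e1, _⟩ | ⟨e1, _⟩ <;>
    rcases max_cases 0 ((1 - η) * R.2 - 2 * η) with ⟨e2, _⟩ | ⟨e2, _⟩ <;>
    rw [e1, e2] <;> linarith

theorem ach1_closure {W : X → Y1 × Y2 → ℝ} (hW : IsChannel W) (hln : EssLessNoisy W) {R : ℝ × ℝ}
    (h : Ach1 W R) : R ∈ closure {R | Ach0 W R} := by
  have hcont : Continuous (fun η : ℝ =>
      ((max 0 ((1 - η) * R.1 - 4 * η), max 0 ((1 - η) * R.2 - 2 * η)) : ℝ × ℝ)) := by fun_prop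
  have ht := (hcont.tendsto 0).mono_left (nhdsWithin_le_nhds (s := Set.Ioi (0:ℝ)))
  have e : ((max 0 ((1 - (0:ℝ)) * R.1 - 4 * 0), max 0 ((1 - (0:ℝ)) * R.2 - 2 * 0)) : ℝ × ℝ) = R := by
    ext <;> simp [h.1, h.2.1]
  rw [e] at ht
  refine mem_closure_of_tendsto ht ?_
  filter_upwards [Ioo_mem_nhdsGT (zero_lt_one' ℝ)] with η hη
  exact ach1_pt hW hln h hη.1 hη.2

end Final

/-- **Proposition 2.** If `p_{Y1|X}` is essentially less noisy than `p_{Y2|X}`,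
then `𝒞₁(p_{Y1,Y2|X}) = 𝒞(p_{Y1,Y2|X})`. -/
theorem cap1_eq_cap_of_essLessNoisy
    {X Y1 Y2 : Type} [Fintype X] [Fintype Y1] [Fintype Y2]
    [Nonempty X] [Nonempty Y1] [Nonempty Y2]
    (W : X → Y1 × Y2 → ℝ) (hW : IsChannel W)
    (hln : EssLessNoisy W) :
    Cap1 W = Cap W := by
  apply Set.Subset.antisymm
  · exact closure_minimal (fun R hR => ach1_closure hW hln hR) isClosed_closure
  · exact closure_mono fun R hR => ach0_ach1 hR

end
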